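/- arXiv:cs/0609141 — 3 statements merged into one kernel-verified Lean document; each statement's English description precedes it below -/
import Mathlib

section
/- An n-gon (V_0,…,V_{n−1}) with n ≥ 4 is strictly convex if and only if for all i ∈ {2,…,n−2} the sign conditions a_i·b_i > 0, a_i·b_{i+1} > 0, and c_i·c_{i+1} > 0 hold, where a_i = sign Δ(V_{i−1},V_i,V_{i+1}), b_i = sign Δ(V_0,V_{i−1},V_i), and c_i = sign Δ(V_0,V_1,V_i). -/
/-- Determinant of the 3×3 matrix with rows (1,x_P,y_P), (1,x_Q,y_Q), (1,x_R,y_R). -/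
def det3 (P Q R : ℝ × ℝ) : ℝ :=
  Matrix.det !![1, P.1, P.2; 1, Q.1, Q.2; 1, R.1, R.2]

/-- Dot product on ℝ². -/
def dot2 (a b : ℝ × ℝ) : ℝ := a.1 * b.1 + a.2 * b.2

/-- The points of `S` lie strictly to one side of the segment `[P,Q]`:
there is a line through `P` and `Q` (with normal `nv`) such that all of `S`
lies in one of the open half-planes it bounds. -/
def StrictSide (P Q : ℝ × ℝ) (S : Set (ℝ × ℝ)) : Prop :=
  ∃ nv : ℝ × ℝ, nv ≠ 0 ∧ dot2 nv (Q - P) = 0 ∧ ∀ A ∈ S, 0 < dot2 nv (A - P)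

/-- The points of `S` lie (non-strictly) to one side of the segment `[P,Q]`:
there is a line containing `[P,Q]` bounding a closed half-plane containing `S`. -/
def WeakSide (P Q : ℝ × ℝ) (S : Set (ℝ × ℝ)) : Prop :=
  ∃ nv : ℝ × ℝ, nv ≠ 0 ∧ dot2 nv (Q - P) = 0 ∧ ∀ A ∈ S, 0 ≤ dot2 nv (A - P)

/-- The successor index modulo `n`. -/
def nxt {n : ℕ} (i : Fin n) : Fin n :=
  ⟨(i.val + 1) % n, Nat.mod_lt _ (Nat.zero_lt_of_lt i.isLt)⟩

/-- The polygon `(V 0, …, V (n-1))` is convex: the union of its edges equals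
the boundary of the convex hull of its vertex set. -/
def IsConvexPolygon {n : ℕ} (V : Fin n → ℝ × ℝ) : Prop :=
  (⋃ i : Fin n, segment ℝ (V i) (V (nxt i))) = frontier (convexHull ℝ (Set.range V))

/-- Quasi-strict: no two adjacent vertices are collinear with any other vertex. -/
def QuasiStrict {n : ℕ} (V : Fin n → ℝ × ℝ) : Prop :=
  ∀ i j : Fin n, j ≠ i → j ≠ nxt i → ¬ Collinear ℝ ({V i, V (nxt i), V j} : Set (ℝ × ℝ))

/-- Strict: no three vertices with distinct indices are collinear. -/
def StrictPoly {n : ℕ} (V : Fin n → ℝ × ℝ) : Prop :=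
  ∀ i j k : Fin n, i ≠ j → i ≠ k → j ≠ k → ¬ Collinear ℝ ({V i, V j, V k} : Set (ℝ × ℝ))

/-- The vertices other than the endpoints of edge `i`. -/
def OtherVerts {n : ℕ} (V : Fin n → ℝ × ℝ) (i : Fin n) : Set (ℝ × ℝ) :=
  {P | ∃ j : Fin n, j ≠ i ∧ j ≠ nxt i ∧ P = V j}

/-- The polygon is strictly to one side of each of its edges. -/
def StrictlyToOneSide {n : ℕ} (V : Fin n → ℝ × ℝ) : Prop :=
  ∀ i : Fin n, StrictSide (V i) (V (nxt i)) (OtherVerts V i)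

/-- The polygon is (non-strictly) to one side of each of its edges. -/
def ToOneSide {n : ℕ} (V : Fin n → ℝ × ℝ) : Prop :=
  ∀ i : Fin n, WeakSide (V i) (V (nxt i)) (OtherVerts V i)


theorem det3_eq (P Q R : ℝ × ℝ) : det3 P Q R =
    (Q.1 - P.1) * (R.2 - P.2) - (Q.2 - P.2) * (R.1 - P.1) := by
  simp [det3, Matrix.det_fin_three]; ring

theorem det3_rot (P Q R : ℝ × ℝ) : det3 P Q R = det3 Q R P := by
  simp only [det3_eq]; ring

theorem det3_swap (P Q R : ℝ × ℝ) : det3 P Q R = - det3 Q P R := by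
  simp only [det3_eq]; ring

theorem plucker (J A B C D : ℝ × ℝ) : det3 J A B * det3 J C D - det3 J A C * det3 J B D
    + det3 J A D * det3 J B C = 0 := by
  simp only [det3_eq]; ring

theorem det3_of_collinear {P Q R : ℝ × ℝ} (h : Collinear ℝ ({P, Q, R} : Set (ℝ × ℝ))) :
    det3 P Q R = 0 := by
  rw [collinear_iff_of_mem (p₀ := P) (by simp)] at h
  obtain ⟨v, hv⟩ := h
  obtain ⟨r, hr⟩ := hv Q (by simp)
  obtain ⟨t, ht⟩ := hv R (by simp)
  subst hr ht
  simp [det3_eq]; ring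

theorem collinear_of_det3 {P Q R : ℝ × ℝ} (h : det3 P Q R = 0) :
    Collinear ℝ ({P, Q, R} : Set (ℝ × ℝ)) := by
  rw [det3_eq] at h
  by_cases hPQ : P = Q
  · subst hPQ
    simpa using collinear_pair ℝ P R
  · rw [collinear_iff_of_mem (p₀ := P) (by simp)]
    refine ⟨Q - P, ?_⟩
    intro X hX
    simp only [Set.mem_insert_iff, Set.mem_singleton_iff] at hX
    rcases hX with rfl | rfl | rfl
    · exact ⟨0, by simp⟩
    · exact ⟨1, by simp⟩
    · by_cases h1 : Q.1 - P.1 = 0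
      · have h2 : Q.2 - P.2 ≠ 0 := by
          intro h2
          exact hPQ (Prod.ext (by linarith) (by linarith))
        refine ⟨(X.2 - P.2) / (Q.2 - P.2), ?_⟩
        rw [h1] at h
        have h3 : X.1 - P.1 = 0 := by
          rcases mul_eq_zero.1 (show (Q.2 - P.2) * (X.1 - P.1) = 0 by linarith) with h | h
          · exact absurd h h2
          · exact h
        ext
        · simp [h1]; linarith
        · simp [h2]
      · refine ⟨(X.1 - P.1) / (Q.1 - P.1), ?_⟩
        ext
        · simp [h1]
        · simp
          field_simp
          linarith

/-- Two affine functions vanishing at `P`, `Q` are proportional. -/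
theorem affine_prop {a b : ℝ} {P Q X Y : ℝ × ℝ}
    (hab : a * (Q.1 - P.1) + b * (Q.2 - P.2) = 0) :
    det3 P Q X * (a * (Y.1 - P.1) + b * (Y.2 - P.2)) =
    det3 P Q Y * (a * (X.1 - P.1) + b * (X.2 - P.2)) := by
  simp only [det3_eq]
  linear_combination ((X.2 - P.2) * (Y.1 - P.1) - (X.1 - P.1) * (Y.2 - P.2)) * hab

theorem det3_of_affine {a b : ℝ} {P Q X : ℝ × ℝ} (h0 : ¬ (a = 0 ∧ b = 0))
    (hab : a * (Q.1 - P.1) + b * (Q.2 - P.2) = 0)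
    (hX : a * (X.1 - P.1) + b * (X.2 - P.2) = 0) : det3 P Q X = 0 := by
  rw [det3_eq]
  by_cases ha : a = 0
  · have hb : b ≠ 0 := fun hb => h0 ⟨ha, hb⟩
    apply mul_left_cancel₀ hb
    linear_combination (Q.1 - P.1) * hX - (X.1 - P.1) * hab
  · apply mul_left_cancel₀ ha
    linear_combination (X.2 - P.2) * hab - (Q.2 - P.2) * hX

theorem support {n : ℕ} (V : Fin n → ℝ × ℝ) (i j k : Fin n)
    (hne : det3 (V i) (V j) (V k) ≠ 0) (m : ℝ × ℝ)
    (hm : m ∈ frontier (convexHull ℝ (Set.range V))) :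
    ∃ a b : ℝ, ¬ (a = 0 ∧ b = 0) ∧ ∀ l, a * ((V l).1 - m.1) + b * ((V l).2 - m.2) ≤ 0 := by
  have hint : (interior (convexHull ℝ (Set.range V))).Nonempty := by
    rw [interior_convexHull_nonempty_iff_affineSpan_eq_top]
    have hai : AffineIndependent ℝ ![V i, V j, V k] := by
      rw [affineIndependent_iff_not_collinear_set]
      exact fun h => hne (det3_of_collinear h)
    have := (hai.affineSpan_eq_top_iff_card_eq_finrank_add_one).2 (by simp)
    rw [eq_top_iff, ← this]
    apply affineSpan_mono
    rintro _ ⟨t, rfl⟩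
    fin_cases t <;> simp
  have hconv := convex_convexHull ℝ (Set.range V)
  obtain ⟨f, hf⟩ := geometric_hahn_banach_open_point hconv.interior isOpen_interior hm.2
  have hle : ∀ x ∈ convexHull ℝ (Set.range V), f x ≤ f m := by
    intro x hx
    have hx' : x ∈ closure (interior (convexHull ℝ (Set.range V))) := by
      rw [hconv.closure_interior_eq_closure_of_nonempty_interior hint]
      exact subset_closure hx
    have hcl : IsClosed {x | f x ≤ f m} := isClosed_le f.continuous continuous_const
    exact closure_minimal (fun y hy => (hf y hy).le) hcl hx'
  have hfe : ∀ p : ℝ × ℝ, f p = f (1, 0) * p.1 + f (0, 1) * p.2 := by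
    intro p
    have : p = p.1 • ((1 : ℝ), (0 : ℝ)) + p.2 • ((0 : ℝ), (1 : ℝ)) := by ext <;> simp
    conv_lhs => rw [this]
    rw [map_add, map_smul, map_smul]; simp; ring
  refine ⟨f (1, 0), f (0, 1), ?_, ?_⟩
  · rintro ⟨ha, hb⟩
    obtain ⟨y, hy⟩ := hint
    have := hf y hy
    rw [hfe y, hfe m, ha, hb] at this
    simp at this
  · intro l
    have := hle (V l) (subset_convexHull ℝ _ ⟨l, rfl⟩)
    rw [hfe (V l), hfe m] at this
    linarith

theorem edge_lemma {n : ℕ} (V : Fin n → ℝ × ℝ) (hS : StrictPoly V) (hC : IsConvexPolygon V)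
    (i j k : Fin n) (hi : i ≠ nxt i) (hj : j ≠ i) (hj' : j ≠ nxt i) (hk : k ≠ i) (hk' : k ≠ nxt i) :
    0 < det3 (V i) (V (nxt i)) (V j) * det3 (V i) (V (nxt i)) (V k) := by
  have hdj : det3 (V i) (V (nxt i)) (V j) ≠ 0 :=
    fun h => hS i (nxt i) j hi hj.symm hj'.symm (collinear_of_det3 h)
  have hdk : det3 (V i) (V (nxt i)) (V k) ≠ 0 :=
    fun h => hS i (nxt i) k hi hk.symm hk'.symm (collinear_of_det3 h)
  have hm : midpoint ℝ (V i) (V (nxt i)) ∈ frontier (convexHull ℝ (Set.range V)) := by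
    rw [← hC]
    exact Set.mem_iUnion.2 ⟨i, midpoint_mem_segment _ _⟩
  obtain ⟨a, b, h0, hl⟩ := support V i (nxt i) j hdj _ hm
  have e1 : (midpoint ℝ (V i) (V (nxt i))).1 = ((V i).1 + (V (nxt i)).1) / 2 := by
    simp [midpoint_eq_smul_add]; ring
  have e2 : (midpoint ℝ (V i) (V (nxt i))).2 = ((V i).2 + (V (nxt i)).2) / 2 := by
    simp [midpoint_eq_smul_add]; ring
  rw [e1, e2] at hl
  have h1 := hl i
  have h2 := hl (nxt i)
  have hab : a * ((V (nxt i)).1 - (V i).1) + b * ((V (nxt i)).2 - (V i).2) = 0 := by linarith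
  have key : ∀ l, det3 (V i) (V (nxt i)) (V l) ≠ 0 →
      a * ((V l).1 - (V i).1) + b * ((V l).2 - (V i).2) < 0 := by
    intro l hd
    refine lt_of_le_of_ne ?_ fun h => hd (det3_of_affine h0 hab h)
    have := hl l
    linarith
  have kj := key j hdj
  have kk := key k hdk
  have hp := affine_prop (X := V j) (Y := V k) hab
  generalize det3 (V i) (V (nxt i)) (V j) = x at *
  generalize det3 (V i) (V (nxt i)) (V k) = y at *
  generalize a * ((V j).1 - (V i).1) + b * ((V j).2 - (V i).2) = u at *
  generalize a * ((V k).1 - (V i).1) + b * ((V k).2 - (V i).2) = v at *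
  have h3 : 0 < y * y := mul_self_pos.2 hdk
  have : (x * y) * v = (y * y) * u := by linear_combination y * hp
  by_contra hcon
  push Not at hcon
  nlinarith [mul_nonneg_of_nonpos_of_nonpos hcon kk.le, mul_neg_of_pos_of_neg h3 kj]

theorem sign_mul_pos {x y : ℝ} : 0 < Real.sign x * Real.sign y ↔ 0 < x * y := by
  rcases lt_trichotomy x 0 with hx | hx | hx <;> rcases lt_trichotomy y 0 with hy | hy | hy
  · simp [Real.sign_of_neg, hx, hy, mul_pos_of_neg_of_neg]
  · simp [hy]
  · have := mul_neg_of_neg_of_pos hx hy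
    rw [Real.sign_of_neg hx, Real.sign_of_pos hy]
    constructor <;> intro h <;> linarith
  · simp [hx]
  · simp [hx]
  · simp [hx]
  · have := mul_neg_of_pos_of_neg hx hy
    rw [Real.sign_of_pos hx, Real.sign_of_neg hy]
    constructor <;> intro h <;> linarith
  · simp [hy]
  · simp [Real.sign_of_pos, hx, hy]

theorem pos_of_mul_eq {x y p q r t : ℝ} (hx : 0 < x) (hp : 0 < p) (hq : 0 < q) (hr : 0 < r)
    (ht : 0 < t) (h : x * y = p * q + r * t) : 0 < y := by
  have : 0 < x * y := by rw [h]; positivity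
  exact (mul_pos_iff_of_pos_left hx).1 this

theorem chain (W : ℕ → ℝ × ℝ) (n : ℕ) (s : ℝ)
    (hb : ∀ i, 1 ≤ i → i + 1 < n → 0 < s * det3 (W 0) (W i) (W (i + 1)))
    (hc : ∀ i, 2 ≤ i → i < n → 0 < s * det3 (W 0) (W 1) (W i))
    (ha : ∀ i, 1 ≤ i → i + 2 < n → 0 < s * det3 (W i) (W (i + 1)) (W (i + 2))) :
    ∀ i j k, i < j → j < k → k < n → 0 < s * det3 (W i) (W j) (W k) := by
  have h0 : ∀ i, 1 ≤ i → ∀ j, i + 1 ≤ j → j < n → 0 < s * det3 (W 0) (W i) (W j) := by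
    intro i hi j hij
    induction j, hij using Nat.le_induction with
    | base => exact fun h => hb i hi h
    | succ j hij ih =>
      intro hj
      rcases Nat.eq_or_lt_of_le hi with rfl | hi1
      · exact hc _ (by omega) hj
      · have hpl := plucker (W 0) (W 1) (W i) (W j) (W (j + 1))
        refine pos_of_mul_eq (hc j (by omega) (by omega)) (hc i (by omega) (by omega))
          (hb j (by omega) hj) (hc (j + 1) (by omega) hj) (ih (by omega)) ?_
        linear_combination (-s ^ 2) * hpl
  have h1 : ∀ L i j k, k ≤ i + L → 1 ≤ i → i < j → j < k → k < n →
      0 < s * det3 (W i) (W j) (W k) := by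
    intro L
    induction L with
    | zero => intro i j k; omega
    | succ L ih =>
      intro i j k hL hi hij hjk hk
      by_cases hj1 : j + 1 < k
      · have e1 := ih i j (j + 1) (by omega) hi hij (by omega) (by omega)
        have e2 := ih j (j + 1) k (by omega) (by omega) (by omega) (by omega) (by omega)
        have e3 := h0 i hi j hij (by omega)
        have e4 := h0 j (by omega) (j + 1) (by omega) (by omega)
        have e5 := h0 j (by omega) k (by omega) (by omega)
        refine pos_of_mul_eq e4 e3 e2 e5 e1 ?_
        simp only [det3_eq]; ring
      · by_cases hi1 : i + 1 < j
        · have e1 := ih i (i + 1) j (by omega) hi (by omega) (by omega) (by omega)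
          have e2 := ih (i + 1) j k (by omega) (by omega) (by omega) (by omega) (by omega)
          have e3 := h0 i hi j (by omega) (by omega)
          have e4 := h0 (i + 1) (by omega) j (by omega) (by omega)
          have e5 := h0 j (by omega) k (by omega) (by omega)
          refine pos_of_mul_eq e4 e3 e2 e5 e1 ?_
          simp only [det3_eq]; ring
        · obtain rfl : j = i + 1 := by omega
          obtain rfl : k = i + 2 := by omega
          exact ha i hi hk
  intro i j k hij hjk hk
  rcases Nat.eq_zero_or_pos i with rfl | hi
  · exact h0 j (by omega) k (by omega) hk
  · exact h1 k i j k (by omega) hi hij hjk hk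

theorem nxt_val {n : ℕ} (i : Fin n) :
    (i.val + 1 < n ∧ (nxt i).val = i.val + 1) ∨ (i.val + 1 = n ∧ (nxt i).val = 0) := by
  have := i.isLt
  rcases Nat.lt_or_ge (i.val + 1) n with h | h
  · exact Or.inl ⟨h, by simp [nxt, Nat.mod_eq_of_lt h]⟩
  · have : i.val + 1 = n := by omega
    exact Or.inr ⟨this, by simp [nxt, this]⟩

theorem det3_ne {n : ℕ} (V : Fin n → ℝ × ℝ) (s : ℝ)
    (hpos : ∀ i j k, i < j → j < k → 0 < s * det3 (V i) (V j) (V k)) (i j k : Fin n)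
    (hij : i ≠ j) (hik : i ≠ k) (hjk : j ≠ k) : det3 (V i) (V j) (V k) ≠ 0 := by
  intro h
  have r1 := det3_rot (V i) (V j) (V k)
  have r2 := det3_rot (V j) (V k) (V i)
  have r3 := det3_swap (V i) (V j) (V k)
  have r4 := det3_swap (V j) (V k) (V i)
  have r5 := det3_swap (V k) (V i) (V j)
  have aux : ∀ i j k, i < j → j < k → det3 (V i) (V j) (V k) ≠ 0 := by
    intro i j k h1 h2 h3
    have := hpos i j k h1 h2
    rw [h3] at this
    simp at this
  rcases lt_or_gt_of_ne hij with h1 | h1 <;> rcases lt_or_gt_of_ne hik with h2 | h2 <;>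
    rcases lt_or_gt_of_ne hjk with h3 | h3
  · exact aux i j k h1 h3 h
  · exact aux i k j h2 h3 (by linarith)
  · exact absurd (h1.trans h3) (not_lt.2 h2.le)
  · exact aux k i j h2 h1 (by linarith)
  · exact aux j i k h1 h2 (by linarith)
  · exact absurd (h3.trans h1) (not_lt.2 h2.le)
  · exact aux j k i h3 h2 (by linarith)
  · exact aux k j i h3 h1 (by linarith)

theorem edge_nonneg {n : ℕ} (V : Fin n → ℝ × ℝ) (s : ℝ)
    (hpos : ∀ i j k, i < j → j < k → 0 < s * det3 (V i) (V j) (V k)) (i l : Fin n) :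
    0 ≤ s * det3 (V i) (V (nxt i)) (V l) := by
  have hz1 : ∀ P Q, det3 P Q P = 0 := by intro P Q; simp only [det3_eq]; ring
  have hz2 : ∀ P Q, det3 P Q Q = 0 := by intro P Q; simp only [det3_eq]; ring
  by_cases h1 : l = i
  · rw [h1, hz1]; simp
  by_cases h2 : l = nxt i
  · rw [h2, hz2]; simp
  have h1' : l.val ≠ i.val := fun h => h1 (Fin.ext h)
  have h2' : l.val ≠ (nxt i).val := fun h => h2 (Fin.ext h)
  have hl := l.isLt
  rcases nxt_val i with ⟨h, e⟩ | ⟨h, e⟩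
  · rcases lt_or_gt_of_ne h1' with h3 | h3
    · rw [← det3_rot]
      exact (hpos l i (nxt i) h3 (by rw [Fin.lt_def]; omega)).le
    · exact (hpos i (nxt i) l (by rw [Fin.lt_def]; omega) (by rw [Fin.lt_def]; omega)).le
  · rw [det3_rot]
    exact (hpos (nxt i) l i (by rw [Fin.lt_def]; omega) (by rw [Fin.lt_def]; omega)).le

theorem frontier_edge {n : ℕ} (V : Fin n → ℝ × ℝ) (s : ℝ)
    (hne : ∀ i, ∃ l, det3 (V i) (V (nxt i)) (V l) ≠ 0) (hs : s ≠ 0)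
    (he : ∀ i l, 0 ≤ s * det3 (V i) (V (nxt i)) (V l)) (i : Fin n) (x : ℝ × ℝ)
    (hx : x ∈ segment ℝ (V i) (V (nxt i))) : x ∈ frontier (convexHull ℝ (Set.range V)) := by
  have hxK : x ∈ convexHull ℝ (Set.range V) :=
    segment_subset_convexHull (Set.mem_range_self i) (Set.mem_range_self (nxt i)) hx
  refine ⟨subset_closure hxK, fun hint => ?_⟩
  set P := V i
  set Q := V (nxt i)
  -- all of the hull is on one side
  have hK : ∀ y ∈ convexHull ℝ (Set.range V), 0 ≤ s * det3 P Q y := by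
    have hcv : Convex ℝ {y : ℝ × ℝ | 0 ≤ s * det3 P Q y} := by
      intro y hy z hz a b ha hb hab
      simp only [Set.mem_ofPred_eq] at hy hz ⊢
      have : s * det3 P Q (a • y + b • z) = a * (s * det3 P Q y) + b * (s * det3 P Q z) := by
        simp only [det3_eq, Prod.fst_add, Prod.snd_add, Prod.smul_fst, Prod.smul_snd, smul_eq_mul]
        linear_combination (s * ((Q.1 - P.1) * P.2 - (Q.2 - P.2) * P.1)) * hab
      rw [this]; positivity
    exact fun y hy => convexHull_min (by rintro _ ⟨l, rfl⟩; exact he i l) hcv hy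
  have hx0 : det3 P Q x = 0 := by
    obtain ⟨a, b, ha, hb, hab, rfl⟩ := hx
    simp only [det3_eq, Prod.fst_add, Prod.snd_add, Prod.smul_fst, Prod.smul_snd, smul_eq_mul]
    linear_combination (P.1 * (Q.2 - P.2) - P.2 * (Q.1 - P.1)) * (-hab)
  obtain ⟨l, hl⟩ := hne i
  -- move slightly away from `V l`
  have hcont : Continuous (fun t : ℝ => x + t • (x - V l)) := by fun_prop
  have hnh : ∀ᶠ t in nhds (0 : ℝ), x + t • (x - V l) ∈ interior (convexHull ℝ (Set.range V)) := by
    apply hcont.continuousAt.eventually_mem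
    simpa using isOpen_interior.mem_nhds hint
  obtain ⟨ε, hε, hball⟩ := Metric.eventually_nhds_iff.1 hnh
  have hm := hK _ (interior_subset (hball (y := ε / 2) (by
    rw [Real.dist_eq, sub_zero, abs_of_pos (by positivity)]; linarith)))
  have hlp : 0 < s * det3 P Q (V l) := lt_of_le_of_ne (he i l) (mul_ne_zero hs hl).symm
  have : s * det3 P Q (x + (ε / 2) • (x - V l)) = -(ε / 2) * (s * det3 P Q (V l)) := by
    have e : det3 P Q (x + (ε / 2) • (x - V l)) =
        (1 + ε / 2) * det3 P Q x - (ε / 2) * det3 P Q (V l) := by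
      simp only [det3_eq, Prod.fst_add, Prod.snd_add, Prod.smul_fst, Prod.smul_snd, smul_eq_mul,
        Prod.fst_sub, Prod.snd_sub]
      ring
    rw [e, hx0]; ring
  rw [this] at hm
  nlinarith [mul_pos (half_pos hε) hlp]

theorem mem_edge {n : ℕ} (hn : 4 ≤ n) (V : Fin n → ℝ × ℝ) (s : ℝ)
    (hpos : ∀ i j k, i < j → j < k → 0 < s * det3 (V i) (V j) (V k)) (x : ℝ × ℝ)
    (hx : x ∈ frontier (convexHull ℝ (Set.range V))) :
    ∃ i, x ∈ segment ℝ (V i) (V (nxt i)) := by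
  have hne := det3_ne V s hpos
  obtain ⟨a, b, h0, hl⟩ := support V ⟨0, by omega⟩ ⟨1, by omega⟩ ⟨2, by omega⟩
    (hne _ _ _ (by simp) (by simp) (by simp)) x hx
  have hxK : x ∈ convexHull ℝ (Set.range V) := by
    have := hx.1
    rwa [((Set.finite_range V).isClosed_convexHull ℝ).closure_eq] at this
  obtain ⟨w, hw0, hw1, hwx⟩ : ∃ w : Fin n → ℝ, (∀ i, 0 ≤ w i) ∧ ∑ i, w i = 1 ∧
      ∑ i, w i • V i = x := by
    have hr : convexHull ℝ (Set.range V) ⊆ {x | ∃ w : Fin n → ℝ, (∀ i, 0 ≤ w i) ∧ ∑ i, w i = 1 ∧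
      ∑ i, w i • V i = x} := by
      apply convexHull_min
      · rintro _ ⟨l, rfl⟩
        refine ⟨fun i => if i = l then 1 else 0, fun i => ?_, by simp, by simp⟩
        dsimp only
        split_ifs <;> norm_num
      · rintro _ ⟨w, hw, hw1, rfl⟩ _ ⟨u, hu, hu1, rfl⟩ c d hc hd hcd
        refine ⟨fun i => c * w i + d * u i, fun i => ?_, ?_, ?_⟩
        · have := hw i
          have := hu i
          positivity
        · rw [Finset.sum_add_distrib, ← Finset.mul_sum, ← Finset.mul_sum, hw1, hu1]
          simpa using hcd
        · simp only [add_smul, mul_smul, Finset.sum_add_distrib, Finset.smul_sum]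
    exact hr hxK
  -- the supporting functional vanishes on the support of `w`
  have hx1 : ∑ i, w i * (V i).1 = x.1 := by
    rw [← hwx, Prod.fst_sum]; simp
  have hx2 : ∑ i, w i * (V i).2 = x.2 := by
    rw [← hwx, Prod.snd_sum]; simp
  have hsum : ∑ i, w i * (-(a * ((V i).1 - x.1) + b * ((V i).2 - x.2))) = 0 := by
    have : ∀ i, w i * (-(a * ((V i).1 - x.1) + b * ((V i).2 - x.2))) =
      (a * x.1 + b * x.2) * w i - a * (w i * (V i).1) - b * (w i * (V i).2) := by intro i; ring
    simp only [this, Finset.sum_sub_distrib, ← Finset.mul_sum, hx1, hx2, hw1]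
    ring
  have hz : ∀ i, w i ≠ 0 → a * ((V i).1 - x.1) + b * ((V i).2 - x.2) = 0 := by
    intro i hi
    have := (Finset.sum_eq_zero_iff_of_nonneg (fun i _ =>
      mul_nonneg (hw0 i) (by linarith [hl i]))).1 hsum i (Finset.mem_univ i)
    rcases mul_eq_zero.1 this with h | h
    · exact absurd h hi
    · linarith
  have hthree : ∀ i j k, i ≠ j → i ≠ k → j ≠ k → w i ≠ 0 → w j ≠ 0 →
      a * ((V k).1 - x.1) + b * ((V k).2 - x.2) = 0 → False := by
    intro i j k hij hik hjk hi hj hk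
    have h1 := hz i hi
    have h2 := hz j hj
    exact hne i j k hij hik hjk (det3_of_affine h0 (by linarith) (by linarith))
  obtain ⟨i, hi⟩ : ∃ i, w i ≠ 0 := by
    by_contra hcon
    push Not at hcon
    simp [hcon] at hw1
  by_cases hex : ∃ j, j ≠ i ∧ w j ≠ 0
  · have key : ∀ i j : Fin n, i < j → w i ≠ 0 → w j ≠ 0 →
        ∃ i, x ∈ segment ℝ (V i) (V (nxt i)) := by
      intro i j hij hi hj
      have hrest : ∀ k, k ≠ i ∧ k ≠ j → w k = 0 := by
        intro k hk
        by_contra hwk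
        exact hthree i j k hij.ne hk.1.symm hk.2.symm hi hj (hz k hwk)
      have hseg : x ∈ segment ℝ (V i) (V j) := by
        refine ⟨w i, w j, hw0 i, hw0 j, ?_, ?_⟩
        · rw [← hw1]
          exact (Fintype.sum_eq_add i j hij.ne hrest).symm
        · rw [← hwx]
          exact (Fintype.sum_eq_add (f := fun k => w k • V k) i j hij.ne (fun k hk => by
            simp only [hrest k hk, zero_smul])).symm
      have hij' : i.val < j.val := hij
      have hjn := j.isLt
      by_cases c1 : j.val = i.val + 1
      · have : nxt i = j := by
          apply Fin.ext
          rcases nxt_val i with h | h <;> omega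
        exact ⟨i, this ▸ hseg⟩
      by_cases c2 : i.val = 0 ∧ j.val = n - 1
      · have : nxt j = i := by
          apply Fin.ext
          rcases nxt_val j with h | h <;> omega
        exact ⟨j, by rw [this, segment_symm]; exact hseg⟩
      exfalso
      let p : Fin n := ⟨i.val + 1, by omega⟩
      have hip : i < p := by rw [Fin.lt_def]; simp [p]
      have hpj : p < j := by rw [Fin.lt_def]; simp only [p]; omega
      have hp := hpos i p j hip hpj
      rw [← det3_rot (V j) (V i) (V p), det3_swap] at hp
      obtain ⟨q, hqi, hqj, hq⟩ : ∃ q, i ≠ q ∧ j ≠ q ∧ 0 < s * det3 (V i) (V j) (V q) := by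
        by_cases c3 : i.val = 0
        · have : j < (⟨n - 1, by omega⟩ : Fin n) := by rw [Fin.lt_def]; simp only; omega
          exact ⟨_, (hij.trans this).ne, this.ne, hpos i j _ hij this⟩
        · have : (⟨0, by omega⟩ : Fin n) < i := by rw [Fin.lt_def]; simp only; omega
          exact ⟨_, this.ne', (this.trans hij).ne', by rw [← det3_rot]; exact hpos _ i j this hij⟩
      have hzi := hz i hi
      have hzj := hz j hj
      have hpr := affine_prop (a := a) (b := b) (P := V i) (Q := V j) (X := V p) (Y := V q)
        (by linarith)
      have fp : a * ((V p).1 - (V i).1) + b * ((V p).2 - (V i).2) < 0 := by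
        refine lt_of_le_of_ne (by linarith [hl p]) fun h => ?_
        exact hthree i j p hij.ne hip.ne hpj.ne' hi hj (by linarith)
      have fq : a * ((V q).1 - (V i).1) + b * ((V q).2 - (V i).2) < 0 := by
        refine lt_of_le_of_ne (by linarith [hl q]) fun h => ?_
        exact hthree i j q hij.ne hqi hqj hi hj (by linarith)
      have m1 := mul_neg_of_pos_of_neg hp fq
      have m2 := mul_neg_of_pos_of_neg hq fp
      have : (s * -det3 (V i) (V j) (V p)) * (a * ((V q).1 - (V i).1) + b * ((V q).2 - (V i).2)) =
        - ((s * det3 (V i) (V j) (V q)) * (a * ((V p).1 - (V i).1) + b * ((V p).2 - (V i).2))) := by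
        linear_combination (-s) * hpr
      linarith
    obtain ⟨j, hji, hj⟩ := hex
    rcases lt_or_gt_of_ne hji with h | h
    · exact key j i h hj hi
    · exact key i j h hi hj
  · push Not at hex
    refine ⟨i, ?_⟩
    have h1 : w i = 1 := by
      rw [← hw1]; exact (Fintype.sum_eq_single i hex).symm
    have h2 : V i = x := by
      rw [← hwx, Fintype.sum_eq_single i (fun k hk => by rw [hex k hk, zero_smul]), h1, one_smul]
    rw [← h2]
    exact left_mem_segment ℝ _ _

theorem backward (n : ℕ) (hn : 4 ≤ n) (V : Fin n → ℝ × ℝ) (s : ℝ)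
    (hpos : ∀ i j k, i < j → j < k → 0 < s * det3 (V i) (V j) (V k)) :
    StrictPoly V ∧ IsConvexPolygon V := by
  have hne := det3_ne V s hpos
  refine ⟨fun i j k h1 h2 h3 h => hne i j k h1 h2 h3 (det3_of_collinear h), ?_⟩
  have hs : s ≠ 0 := by
    rintro rfl
    have := hpos ⟨0, by omega⟩ ⟨1, by omega⟩ ⟨2, by omega⟩ (by simp) (by simp)
    simp at this
  have hn1 : ∀ i : Fin n, ∃ l, det3 (V i) (V (nxt i)) (V l) ≠ 0 := by
    intro i
    have h1 : i ≠ nxt i := by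
      intro h
      have := congrArg Fin.val h
      rcases nxt_val i with h | h <;> omega
    refine ⟨nxt (nxt i), hne _ _ _ h1 ?_ ?_⟩
    · intro h
      have := congrArg Fin.val h
      rcases nxt_val i with h | h <;> rcases nxt_val (nxt i) with h' | h' <;> omega
    · intro h
      have := congrArg Fin.val h
      rcases nxt_val (nxt i) with h | h <;> omega
  apply Set.Subset.antisymm
  · intro x hx
    obtain ⟨i, hi⟩ := Set.mem_iUnion.1 hx
    exact frontier_edge V s hn1 hs (edge_nonneg V s hpos) i x hi
  · intro x hx
    exact Set.mem_iUnion.2 (mem_edge hn V s hpos x hx)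

theorem mul_pos_trans {x y z : ℝ} (h1 : 0 < x * y) (h2 : 0 < y * z) : 0 < x * z := by
  have hy : y ≠ 0 := by rintro rfl; simp at h1
  have h3 : 0 < y * y := mul_self_pos.2 hy
  have h4 : 0 < (y * y) * (x * z) := by
    have := mul_pos h1 h2
    linarith [show x * y * (y * z) = (y * y) * (x * z) by ring]
  exact (mul_pos_iff_of_pos_left h3).1 h4

/-- Pinelis, Theorem 1 (the O(n) test): an n-gon with n ≥ 4 is strictly convex
iff `a_i b_i > 0`, `a_i b_{i+1} > 0`, `c_i c_{i+1} > 0` for all i ∈ {2,…,n−2}. -/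
theorem stmt_7 (n : ℕ) (hn : 4 ≤ n) (V : Fin n → ℝ × ℝ) :
    (StrictPoly V ∧ IsConvexPolygon V) ↔
      (∀ i : Fin n, 2 ≤ i.val → i.val ≤ n - 2 →
        0 < Real.sign (det3 (V ⟨i.val - 1, lt_of_le_of_lt (Nat.sub_le _ _) i.isLt⟩)
              (V i) (V (nxt i))) *
            Real.sign (det3 (V ⟨0, by omega⟩)
              (V ⟨i.val - 1, lt_of_le_of_lt (Nat.sub_le _ _) i.isLt⟩) (V i)) ∧
        0 < Real.sign (det3 (V ⟨i.val - 1, lt_of_le_of_lt (Nat.sub_le _ _) i.isLt⟩)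
              (V i) (V (nxt i))) *
            Real.sign (det3 (V ⟨0, by omega⟩) (V i) (V (nxt i))) ∧
        0 < Real.sign (det3 (V ⟨0, by omega⟩) (V ⟨1, by omega⟩) (V i)) *
            Real.sign (det3 (V ⟨0, by omega⟩) (V ⟨1, by omega⟩) (V (nxt i)))) := by
  constructor
  · rintro ⟨hS, hC⟩ i hi2 hin
    have hiv := i.isLt
    simp only [sign_mul_pos]
    have hv : (nxt i).val = i.val + 1 := by rcases nxt_val i with h | h <;> omega
    have hp : nxt (⟨i.val - 1, lt_of_le_of_lt (Nat.sub_le _ _) i.isLt⟩ : Fin n) = i := by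
      apply Fin.ext
      rcases nxt_val (⟨i.val - 1, lt_of_le_of_lt (Nat.sub_le _ _) i.isLt⟩ : Fin n) with h | h <;>
        simp only at h <;> omega
    have h01 : nxt (⟨0, by omega⟩ : Fin n) = ⟨1, by omega⟩ := by
      apply Fin.ext
      rcases nxt_val (⟨0, by omega⟩ : Fin n) with h | h <;> simp only at h ⊢ <;> omega
    refine ⟨?_, ?_, ?_⟩
    · have := edge_lemma V hS hC ⟨i.val - 1, lt_of_le_of_lt (Nat.sub_le _ _) i.isLt⟩
        (nxt i) ⟨0, by omega⟩
      rw [hp] at this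
      rw [det3_rot (V ⟨0, by omega⟩)]
      apply this <;> rw [Ne, Fin.ext_iff] <;> (try simp only) <;> omega
    · have := edge_lemma V hS hC i ⟨i.val - 1, lt_of_le_of_lt (Nat.sub_le _ _) i.isLt⟩
        ⟨0, by omega⟩
      rw [det3_rot (V ⟨0, by omega⟩), det3_rot (V ⟨i.val - 1, _⟩)]
      apply this <;> rw [Ne, Fin.ext_iff] <;> (try simp only) <;> omega
    · have := edge_lemma V hS hC ⟨0, by omega⟩ i (nxt i)
      rw [h01] at this
      apply this <;> rw [Ne, Fin.ext_iff] <;> (try simp only) <;> omega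
  · intro H
    simp only [sign_mul_pos] at H
    let W : ℕ → ℝ × ℝ := fun k => if h : k < n then V ⟨k, h⟩ else 0
    have hW : ∀ k (h : k < n), V ⟨k, h⟩ = W k := fun k h => by simp [W, h]
    have H' : ∀ i, 2 ≤ i → i + 1 < n →
        0 < det3 (W (i - 1)) (W i) (W (i + 1)) * det3 (W 0) (W (i - 1)) (W i) ∧
        0 < det3 (W (i - 1)) (W i) (W (i + 1)) * det3 (W 0) (W i) (W (i + 1)) ∧
        0 < det3 (W 0) (W 1) (W i) * det3 (W 0) (W 1) (W (i + 1)) := by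
      intro i h2 hi
      have := H ⟨i, by omega⟩ h2 (by simp only; omega)
      have hx : nxt (⟨i, by omega⟩ : Fin n) = ⟨i + 1, hi⟩ := by
        apply Fin.ext
        rcases nxt_val (⟨i, by omega⟩ : Fin n) with h | h <;> simp only at h ⊢ <;> omega
      rw [hx] at this
      simpa only [hW] using this
    have hb : ∀ i, 1 ≤ i → i + 1 < n →
        0 < det3 (W 0) (W 1) (W 2) * det3 (W 0) (W i) (W (i + 1)) := by
      intro i hi
      induction i, hi using Nat.le_induction with
      | base =>
        intro _
        have h := (H' 2 le_rfl (by omega)).1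
        exact mul_self_pos.2 fun h0 => by
          norm_num at h
          rw [h0] at h
          simp at h
      | succ i hi ih =>
        intro hn'
        obtain ⟨h1, h2, -⟩ := H' (i + 1) (by omega) hn'
        rw [mul_comm] at h1
        exact mul_pos_trans (ih (by omega)) (mul_pos_trans h1 h2)
    have hc : ∀ i, 2 ≤ i → i < n → 0 < det3 (W 0) (W 1) (W 2) * det3 (W 0) (W 1) (W i) := by
      intro i hi
      induction i, hi using Nat.le_induction with
      | base => exact fun _ => hb 1 le_rfl (by omega)
      | succ i hi ih => exact fun hn' => mul_pos_trans (ih (by omega)) (H' i hi hn').2.2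
    have ha : ∀ i, 1 ≤ i → i + 2 < n →
        0 < det3 (W 0) (W 1) (W 2) * det3 (W i) (W (i + 1)) (W (i + 2)) := by
      intro i hi hn'
      have h := (H' (i + 1) (by omega) hn').1
      rw [mul_comm] at h
      exact mul_pos_trans (hb i hi (by omega)) h
    have hpos := chain W n _ hb hc ha
    refine backward n hn V (det3 (W 0) (W 1) (W 2)) fun i j k hij hjk => ?_
    have := hpos i j k hij hjk k.isLt
    simpa only [← hW _ i.isLt, ← hW _ j.isLt, ← hW _ k.isLt] using this
end

section
/- If a polygon P = (V_0,…,V_{n−1}) is quasi-strictly convex, then the polygon obtained by deleting the last vertex, P' = (V_0,…,V_{n−2}), is also quasi-strictly convex. -/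
abbrev Fnl := ℝ × ℝ →L[ℝ] ℝ

lemma fnl_apply (f : Fnl) (p : ℝ × ℝ) : f p = f (1, 0) * p.1 + f (0, 1) * p.2 := by
  have h : p = p.1 • ((1, 0) : ℝ × ℝ) + p.2 • ((0, 1) : ℝ × ℝ) := by ext <;> simp
  conv_lhs => rw [h]
  rw [map_add, map_smul, map_smul]; simp [mul_comm]

lemma fnl_ne (f : Fnl) (hf : f ≠ 0) : 0 < f (1, 0) ^ 2 + f (0, 1) ^ 2 := by
  by_contra h
  have h1 : f (1, 0) = 0 := by nlinarith [sq_nonneg (f (1, 0)), sq_nonneg (f (0, 1))]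
  have h2 : f (0, 1) = 0 := by nlinarith [sq_nonneg (f (1, 0)), sq_nonneg (f (0, 1))]
  apply hf
  refine ContinuousLinearMap.ext fun p => ?_
  rw [fnl_apply, h1, h2]; simp

lemma collinear_of_fnl (f : Fnl) (hf : f ≠ 0) (p q r : ℝ × ℝ) (hq : f q = f p) (hr : f r = f p) :
    Collinear ℝ ({p, q, r} : Set (ℝ × ℝ)) := by
  have hpos := fnl_ne f hf
  have key : ∀ q : ℝ × ℝ, f q = f p → ∃ t : ℝ, q = t • ((-f (0, 1), f (1, 0)) : ℝ × ℝ) + p := by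
    intro q hq
    rw [fnl_apply f q, fnl_apply f p] at hq
    generalize f (1, 0) = a at *
    generalize f (0, 1) = b at *
    refine ⟨((q.2 - p.2) * a - (q.1 - p.1) * b) / (a ^ 2 + b ^ 2), ?_⟩
    have := hpos.ne'
    ext
    · simp only [Prod.fst_add, Prod.smul_fst, smul_eq_mul]
      field_simp
      linear_combination a * hq
    · simp only [Prod.snd_add, Prod.smul_snd, smul_eq_mul]
      field_simp
      linear_combination b * hq
  rw [collinear_iff_of_mem (p₀ := p) (by simp)]
  refine ⟨(-f (0, 1), f (1, 0)), ?_⟩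
  intro x hx
  simp only [Set.mem_insert_iff, Set.mem_singleton_iff] at hx
  rcases hx with rfl | rfl | rfl
  · exact key _ rfl
  · exact key _ hq
  · exact key _ hr

lemma interior_ne {n : ℕ} (V : Fin n → ℝ × ℝ) (i j k : Fin n)
    (h : ¬ Collinear ℝ ({V i, V j, V k} : Set (ℝ × ℝ))) :
    (interior (convexHull ℝ (Set.range V))).Nonempty := by
  rw [interior_convexHull_nonempty_iff_affineSpan_eq_top]
  have h1 := affineIndependent_iff_not_collinear_set.2 h
  have h2 := h1.affineSpan_eq_top_iff_card_eq_finrank_add_one.2 (by simp)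
  rw [eq_top_iff, ← h2]
  apply affineSpan_mono
  rintro _ ⟨a, rfl⟩
  fin_cases a <;> simp

lemma support_fnl (K : Set (ℝ × ℝ)) (hK : Convex ℝ K) (hne : (interior K).Nonempty)
    (x : ℝ × ℝ) (hx : x ∉ interior K) : ∃ f : Fnl, f ≠ 0 ∧ ∀ y ∈ K, f y ≤ f x := by
  obtain ⟨f, hf⟩ := geometric_hahn_banach_open_point hK.interior isOpen_interior hx
  refine ⟨f, ?_, ?_⟩
  · rintro rfl
    obtain ⟨y, hy⟩ := hne
    simpa using hf y hy
  · intro y hy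
    have h1 : y ∈ closure (interior K) := by
      rw [hK.closure_interior_eq_closure_of_nonempty_interior hne]; exact subset_closure hy
    have h2 : closure (interior K) ⊆ {y | f y ≤ f x} :=
      closure_minimal (fun z hz => (hf z hz).le) (isClosed_le f.continuous continuous_const)
    exact h2 h1

lemma face_hull {n : ℕ} (V : Fin n → ℝ × ℝ) (x : ℝ × ℝ) (hx : x ∈ convexHull ℝ (Set.range V))
    (f : Fnl) (hf : ∀ j, f (V j) ≤ f x) : x ∈ convexHull ℝ (V '' {j | f (V j) = f x}) := by
  classical
  obtain ⟨ι, _, w, z, hw, hw1, hz, rfl⟩ := mem_convexHull_iff_exists_fintype.1 hx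
  set x := ∑ i, w i • z i with hxd
  have hfz : ∀ i, f (z i) ≤ f x := by
    intro i; obtain ⟨j, hj⟩ := hz i; rw [← hj]; exact hf j
  have hs : ∑ i, w i * (f x - f (z i)) = 0 := by
    have : f x = ∑ i, w i * f (z i) := by rw [hxd]; simp
    simp only [mul_sub, Finset.sum_sub_distrib]
    rw [← Finset.sum_mul, hw1, ← this]; ring
  rw [Finset.sum_eq_zero_iff_of_nonneg
    (fun i _ => mul_nonneg (hw i) (sub_nonneg.2 (hfz i)))] at hs
  have hc : x = Finset.univ.centerMass w z := (Finset.centerMass_eq_of_sum_1 _ _ hw1).symm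
  rw [hc, ← Finset.centerMass_filter_ne_zero]
  apply Finset.centerMass_mem_convexHull
  · intro i _; exact hw i
  · rw [Finset.sum_filter_ne_zero, hw1]; exact one_pos
  · intro i hi
    rw [Finset.mem_filter] at hi
    obtain ⟨j, hj⟩ := hz i
    refine ⟨j, ?_, hj⟩
    have := (mul_eq_zero.1 (hs i (Finset.mem_univ i))).resolve_left hi.2
    simp only [Set.mem_ofPred_eq]
    rw [hj, Finset.centerMass_filter_ne_zero, ← hc]; linarith

/-- Every edge is supported by a functional, strictly at the other vertices. -/
def Good {n : ℕ} (V : Fin n → ℝ × ℝ) : Prop :=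
  ∀ i : Fin n, ∃ f : Fnl, f (V (nxt i)) = f (V i) ∧
    ∀ j, j ≠ i → j ≠ nxt i → f (V j) < f (V i)

lemma nxt_ne {n : ℕ} (hn : 3 ≤ n) (i : Fin n) :
    nxt i ≠ i ∧ nxt (nxt i) ≠ i ∧ nxt (nxt i) ≠ nxt i := by
  obtain ⟨i, hi⟩ := i
  have key : ∀ a, a < n → (a + 1 < n ∧ (a+1) % n = a + 1) ∨ (a + 1 = n ∧ (a+1) % n = 0) := by
    intro a ha
    rcases Nat.lt_or_ge (a+1) n with h | h
    · left; exact ⟨h, Nat.mod_eq_of_lt h⟩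
    · right
      have : a + 1 = n := by omega
      exact ⟨this, by rw [this]; simp⟩
  simp only [nxt, ne_eq, Fin.mk.injEq]
  have h1 := key i hi
  have h2 := key ((i+1) % n) (Nat.mod_lt _ (by omega))
  omega

lemma exists_prev {n : ℕ} (i : Fin n) : ∃ p, nxt p = i := by
  obtain ⟨i, hi⟩ := i
  rcases Nat.eq_zero_or_pos i with rfl | h
  · refine ⟨⟨n - 1, by omega⟩, ?_⟩
    simp only [nxt, Fin.mk.injEq]
    rw [Nat.sub_add_cancel (by omega)]; simp
  · refine ⟨⟨i - 1, by omega⟩, ?_⟩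
    simp only [nxt, Fin.mk.injEq]
    rw [Nat.sub_add_cancel (by omega)]; exact Nat.mod_eq_of_lt hi

lemma Good.inj {n : ℕ} {V : Fin n → ℝ × ℝ} (h : Good V) (hn : 3 ≤ n) {i j : Fin n}
    (hij : i ≠ j) : V i ≠ V j := by
  intro he
  by_cases hj : j = nxt i
  · obtain ⟨h1, h2, h3⟩ := nxt_ne hn i
    obtain ⟨f, -, hf⟩ := h (nxt i)
    have := hf i h1.symm h2.symm
    rw [he, hj] at this
    exact lt_irrefl _ this
  · obtain ⟨f, -, hf⟩ := h i
    have := hf j hij.symm hj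
    rw [he] at this
    exact lt_irrefl _ this

lemma Good.not_wbtw {n : ℕ} {V : Fin n → ℝ × ℝ} (h : Good V) (hn : 3 ≤ n) {i j k : Fin n}
    (hij : i ≠ j) (hik : i ≠ k) (hjk : j ≠ k) : ¬ Wbtw ℝ (V i) (V j) (V k) := by
  rintro ⟨t, ⟨ht0, ht1⟩, ht⟩
  obtain ⟨f, hfe, hf⟩ := h j
  have hfi : f (V i) ≤ f (V j) := by
    by_cases e : i = nxt j
    · rw [e, hfe]
    · exact (hf i hij e).le
  have hfk : f (V k) ≤ f (V j) := by
    by_cases e : k = nxt j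
    · rw [e, hfe]
    · exact (hf k hjk.symm e).le
  have ht0' : 0 < t := by
    rcases ht0.lt_or_eq with h0 | h0
    · exact h0
    · subst h0; simp at ht; exact absurd ht (h.inj hn hij)
  have ht1' : t < 1 := by
    rcases ht1.lt_or_eq with h0 | h0
    · exact h0
    · subst h0; simp at ht; exact absurd ht.symm (h.inj hn hjk)
  have hv : f (V j) = t * (f (V k) - f (V i)) + f (V i) := by
    rw [← ht, AffineMap.lineMap_apply]; simp
  by_cases e : i = nxt j
  · have : f (V k) < f (V j) := hf k hjk.symm (by rw [← e]; exact hik.symm)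
    nlinarith
  · have := hf i hij e
    nlinarith

lemma Good.strict {n : ℕ} {V : Fin n → ℝ × ℝ} (h : Good V) (hn : 3 ≤ n) : StrictPoly V := by
  intro i j k hij hik hjk hc
  rcases hc.wbtw_or_wbtw_or_wbtw with hb | hb | hb
  · exact h.not_wbtw hn hij hik hjk hb
  · exact h.not_wbtw hn hjk hij.symm hik.symm hb
  · exact h.not_wbtw hn hik.symm hjk.symm hij hb

lemma Good.quasi {n : ℕ} {V : Fin n → ℝ × ℝ} (h : Good V) (hn : 3 ≤ n) : QuasiStrict V := by
  intro i j hi hj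
  exact h.strict hn i (nxt i) j (nxt_ne hn i).1.symm hi.symm hj.symm

lemma three_dirs (a b c : ℝ × ℝ) (f g h : Fnl) (gb : g b = 0) (ga : g a < 0) (gc : g c < 0)
    (ha : h a = 0) (hb : h b < 0) (hc : h c < 0) (fc : f c = 0) (fa : f a < 0) (fb : f b < 0) :
    False := by
  set α := b.1 * c.2 - b.2 * c.1 with hα
  set β := c.1 * a.2 - c.2 * a.1 with hβ
  set γ := a.1 * b.2 - a.2 * b.1 with hγ
  have rel : ∀ u : Fnl, α * u a + β * u b + γ * u c = 0 := by
    intro u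
    rw [fnl_apply u a, fnl_apply u b, fnl_apply u c]; ring
  have hγ0 : γ ≠ 0 := by
    intro h0
    have e1 : b.1 * g a = - g (0, 1) * γ + a.1 * g b := by
      rw [fnl_apply g a, fnl_apply g b]; ring
    have e2 : b.2 * g a = g (1, 0) * γ + a.2 * g b := by
      rw [fnl_apply g a, fnl_apply g b]; ring
    rw [h0, gb] at e1 e2
    have b1 : b.1 = 0 := by
      rcases mul_eq_zero.1 (e1.trans (by ring : _ = (0:ℝ))) with h | h
      · exact h
      · exact absurd h ga.ne
    have b2 : b.2 = 0 := by
      rcases mul_eq_zero.1 (e2.trans (by ring : _ = (0:ℝ))) with h | h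
      · exact h
      · exact absurd h ga.ne
    rw [fnl_apply, b1, b2] at hb; simp at hb
  have r1 := rel g
  have r2 := rel h
  have r3 := rel f
  rw [gb] at r1
  rw [ha] at r2
  rw [fc] at r3
  rcases lt_or_gt_of_ne hγ0 with hg | hg
  · have : 0 < α := by by_contra hh; nlinarith [mul_pos_of_neg_of_neg hg gc, mul_nonneg_of_nonpos_of_nonpos (not_lt.1 hh) ga.le]
    have : 0 < β := by by_contra hh; nlinarith [mul_pos_of_neg_of_neg hg hc, mul_nonneg_of_nonpos_of_nonpos (not_lt.1 hh) hb.le]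
    nlinarith
  · have : α < 0 := by by_contra hh; nlinarith [mul_neg_of_pos_of_neg hg gc, mul_nonpos_of_nonneg_of_nonpos (not_lt.1 hh) ga.le]
    have : β < 0 := by by_contra hh; nlinarith [mul_neg_of_pos_of_neg hg hc, mul_nonpos_of_nonneg_of_nonpos (not_lt.1 hh) hb.le]
    nlinarith [mul_pos_of_neg_of_neg ‹α < 0› fa]

lemma Good.adj {n : ℕ} {V : Fin n → ℝ × ℝ} (h : Good V) (hn : 3 ≤ n) {i j : Fin n} (hij : i ≠ j)
    (f : Fnl) (hf : f (V j) = f (V i)) (hk : ∀ k, k ≠ i → k ≠ j → f (V k) < f (V i)) :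
    j = nxt i ∨ i = nxt j := by
  by_contra hcon
  push Not at hcon
  obtain ⟨h1, h2⟩ := hcon
  obtain ⟨p, rfl⟩ := exists_prev i
  obtain ⟨n1, n2, n3⟩ := nxt_ne hn p
  have hjp : j ≠ p := by rintro rfl; exact h2 rfl
  obtain ⟨g, ge, hg⟩ := h (nxt p)
  obtain ⟨u, ue, hu⟩ := h p
  refine three_dirs (V p - V (nxt p)) (V (nxt (nxt p)) - V (nxt p)) (V j - V (nxt p)) f g u
    ?_ ?_ ?_ ?_ ?_ ?_ ?_ ?_ ?_ <;> rw [map_sub]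
  · linarith
  · linarith [hg p n1.symm n2.symm]
  · linarith [hg j hij.symm h1]
  · linarith
  · linarith [hu _ n2 n3]
  · linarith [hu j hjp hij.symm]
  · linarith
  · linarith [hk p n1.symm hjp.symm]
  · linarith [hk _ n3 h1.symm]

lemma Good.convex {n : ℕ} {V : Fin n → ℝ × ℝ} (h : Good V) (hn : 3 ≤ n) : IsConvexPolygon V := by
  have hclosed : IsClosed (convexHull ℝ (Set.range V)) :=
    (Set.finite_range V).isClosed_convexHull ℝ
  have hne : (interior (convexHull ℝ (Set.range V))).Nonempty := by
    apply interior_ne V ⟨0, by omega⟩ ⟨1, by omega⟩ ⟨2, by omega⟩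
    apply h.strict hn <;> simp
  unfold IsConvexPolygon
  rw [hclosed.frontier_eq]
  apply Set.Subset.antisymm
  · intro x hx
    obtain ⟨i, hx⟩ := Set.mem_iUnion.1 hx
    have hxK : x ∈ convexHull ℝ (Set.range V) :=
      (convex_convexHull ℝ _).segment_subset (subset_convexHull ℝ _ (Set.mem_range_self i))
        (subset_convexHull ℝ _ (Set.mem_range_self (nxt i))) hx
    refine ⟨hxK, fun hint => ?_⟩
    obtain ⟨f, fe, hf⟩ := h i
    have hfx : f x = f (V i) := by
      obtain ⟨a, b, -, -, hab, rfl⟩ := hx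
      simp only [map_add, map_smul, smul_eq_mul, fe]
      rw [← add_mul, hab, one_mul]
    have hle : ∀ y ∈ convexHull ℝ (Set.range V), f y ≤ f x := by
      intro y hy
      have : convexHull ℝ (Set.range V) ⊆ {y | f y ≤ f x} := by
        apply convexHull_min
        · rintro _ ⟨j, rfl⟩
          simp only [Set.mem_ofPred_eq]
          rw [hfx]
          by_cases h1 : j = i
          · rw [h1]
          by_cases h2 : j = nxt i
          · rw [h2, fe]
          exact (hf j h1 h2).le
        · exact convex_halfSpace_le f.toLinearMap.isLinear _
      exact this hy
    -- move from x in the direction of V i - V k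
    obtain ⟨n1, n2, n3⟩ := nxt_ne hn i
    have hk := hf _ n2 n3
    have hcont : Continuous fun t : ℝ => x + t • (V i - V (nxt (nxt i))) := by fun_prop
    have hev : ∀ᶠ t in nhds (0 : ℝ), x + t • (V i - V (nxt (nxt i))) ∈
        interior (convexHull ℝ (Set.range V)) := by
      apply hcont.continuousAt.eventually_mem
      simpa using isOpen_interior.mem_nhds hint
    obtain ⟨ε, hε, hball⟩ := Metric.eventually_nhds_iff.1 hev
    have := hle _ (interior_subset (hball (y := ε / 2) (by
      rw [Real.dist_eq, sub_zero, abs_of_pos (by linarith)]; linarith)))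
    rw [map_add, map_smul, map_sub, smul_eq_mul] at this
    nlinarith
  · rintro x ⟨hx, hxi⟩
    obtain ⟨f, f0, hf⟩ := support_fnl _ (convex_convexHull ℝ _) hne x hxi
    have hfV : ∀ j, f (V j) ≤ f x := fun j => hf _ (subset_convexHull ℝ _ ⟨j, rfl⟩)
    have hface := face_hull V x hx f hfV
    have hnn : (V '' {j | f (V j) = f x}).Nonempty := convexHull_nonempty_iff.1 ⟨x, hface⟩
    obtain ⟨_, i, hi, -⟩ := hnn
    simp only [Set.mem_ofPred_eq] at hi
    rw [Set.mem_iUnion]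
    by_cases hex : ∃ j, j ≠ i ∧ f (V j) = f x
    · obtain ⟨j, hji, hj⟩ := hex
      have hk : ∀ k, k ≠ i → k ≠ j → f (V k) ≠ f x := by
        intro k hki hkj hk
        exact h.strict hn i j k hji.symm hki.symm hkj.symm
          (collinear_of_fnl f f0 _ _ _ (hj.trans hi.symm) (hk.trans hi.symm))
      have hseg : x ∈ segment ℝ (V i) (V j) := by
        rw [← convexHull_pair]
        refine convexHull_mono ?_ hface
        rintro _ ⟨k, hkk, rfl⟩
        by_cases e1 : k = i
        · simp [e1]
        by_cases e2 : k = j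
        · simp [e2]
        exact absurd hkk (hk k e1 e2)
      rcases h.adj hn hji.symm f (hj.trans hi.symm)
        (fun k h1 h2 => by rw [hi]; exact lt_of_le_of_ne (hfV k) (hk k h1 h2)) with e | e
      · exact ⟨i, e ▸ hseg⟩
      · refine ⟨j, ?_⟩
        rw [← e, segment_symm]; exact hseg
    · push Not at hex
      refine ⟨i, ?_⟩
      have : x ∈ convexHull ℝ {V i} := by
        refine convexHull_mono ?_ hface
        rintro _ ⟨k, hkk, rfl⟩
        by_cases e1 : k = i
        · simp [e1]
        · exact absurd hkk (hex k e1)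
      rw [convexHull_singleton, Set.mem_singleton_iff] at this
      rw [this]; exact left_mem_segment _ _ _

lemma good_of_convex {n : ℕ} (hn : 3 ≤ n) (V : Fin n → ℝ × ℝ) (hc : IsConvexPolygon V)
    (hq : QuasiStrict V) : Good V := by
  intro i
  obtain ⟨n1, n2, n3⟩ := nxt_ne hn i
  have hne := interior_ne V _ _ _ (hq i _ n2 n3)
  have hclosed : IsClosed (convexHull ℝ (Set.range V)) :=
    (Set.finite_range V).isClosed_convexHull ℝ
  have hm : midpoint ℝ (V i) (V (nxt i)) ∈ frontier (convexHull ℝ (Set.range V)) := by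
    rw [← hc]
    exact Set.mem_iUnion.2 ⟨i, midpoint_mem_segment _ _⟩
  rw [hclosed.frontier_eq] at hm
  obtain ⟨f, f0, hf⟩ := support_fnl _ (convex_convexHull ℝ _) hne _ hm.2
  have hfV : ∀ j, f (V j) ≤ f (midpoint ℝ (V i) (V (nxt i))) :=
    fun j => hf _ (subset_convexHull ℝ _ ⟨j, rfl⟩)
  have hmid : f (midpoint ℝ (V i) (V (nxt i))) = (f (V i) + f (V (nxt i))) / 2 := by
    rw [midpoint_eq_smul_add, map_smul, map_add, smul_eq_mul, invOf_eq_inv]; ring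
  have e1 := hfV i
  have e2 := hfV (nxt i)
  rw [hmid] at e1 e2 hfV
  have e : f (V (nxt i)) = f (V i) := by linarith
  refine ⟨f, e, fun j hj1 hj2 => ?_⟩
  rcases (hfV j).lt_or_eq with hlt | heq
  · linarith
  · exact absurd (collinear_of_fnl f f0 _ _ _ e (by linarith)) (hq i j hj1 hj2)

/-- The functional vanishing on the direction `B - A`. -/
noncomputable def lineF (A B : ℝ × ℝ) : Fnl :=
  (B.1 - A.1) • ContinuousLinearMap.snd ℝ ℝ ℝ - (B.2 - A.2) • ContinuousLinearMap.fst ℝ ℝ ℝ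

lemma lineF_apply (A B p : ℝ × ℝ) :
    lineF A B p = (B.1 - A.1) * p.2 - (B.2 - A.2) * p.1 := by
  simp [lineF]

lemma lineF_eq (A B : ℝ × ℝ) : lineF A B B = lineF A B A := by
  rw [lineF_apply, lineF_apply]; ring

lemma lineF_ne (A B : ℝ × ℝ) (h : A ≠ B) : lineF A B ≠ 0 := by
  intro h0
  apply h
  have e1 := lineF_apply A B (1, 0)
  have e2 := lineF_apply A B (0, 1)
  rw [h0] at e1 e2
  simp at e1 e2
  ext <;> linarith

/-- No crossing: two vertices cannot be on opposite sides. -/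
lemma no_cross (A B P Q : ℝ × ℝ) (hAB : A ≠ B) (f g h : Fnl)
    (fA : f A < f B) (fP : f P < f B) (fQ : f Q < f B)
    (gB : g B < g A) (gP : g P < g A) (gQ : g Q < g A)
    (hPQ : h Q = h P) (hA : h A < h P) (hB : h B < h P)
    (dP : lineF A B P < lineF A B A) (dQ : lineF A B A < lineF A B Q) : False := by
  set L := lineF A B with hL
  set t := (L A - L P) / (L Q - L P) with ht
  have hd : 0 < L Q - L P := by linarith
  have ht0 : 0 < t := div_pos (by linarith) hd
  have ht1 : t < 1 := by rw [ht, div_lt_one hd]; linarith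
  set q := (1 - t) • P + t • Q with hq
  have hLq : L q = L A := by
    rw [hq, map_add, map_smul, map_smul, smul_eq_mul, smul_eq_mul, ht]; field_simp; ring
  obtain ⟨v, hv⟩ := (collinear_iff_of_mem (p₀ := A) (by simp)).1
    (collinear_of_fnl L (lineF_ne A B hAB) A B q (lineF_eq A B) hLq)
  obtain ⟨b, hb⟩ := hv B (by simp)
  obtain ⟨r, hr⟩ := hv q (by simp)
  have hb0 : b ≠ 0 := by
    rintro rfl; apply hAB; rw [hb]; simp
  obtain ⟨s, hs⟩ : ∃ s : ℝ, q = (1 - s) • A + s • B := by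
    refine ⟨r / b, ?_⟩
    rw [hr, hb]
    simp only [vadd_eq_add, smul_add, smul_smul, div_mul_cancel₀ r hb0]
    module
  have key : ∀ u : Fnl, (1 - t) * u P + t * u Q = (1 - s) * u A + s * u B := by
    intro u
    have := congrArg u (hq.symm.trans hs)
    simpa using this
  have kf := key f
  have kg := key g
  have kh := key h
  have s1 : s < 1 := by
    by_contra hh
    nlinarith [mul_pos ht0 (sub_pos.2 fQ), mul_pos (sub_pos.2 ht1) (sub_pos.2 fP),
      mul_nonneg (sub_nonneg.2 (not_lt.1 hh)) (sub_pos.2 fA).le]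
  have s0 : 0 < s := by
    by_contra hh
    nlinarith [mul_pos ht0 (sub_pos.2 gQ), mul_pos (sub_pos.2 ht1) (sub_pos.2 gP),
      mul_nonneg (neg_nonneg.2 (not_lt.1 hh)) (sub_pos.2 gB).le]
  rw [hPQ] at kh
  nlinarith [mul_pos s0 (sub_pos.2 hB), mul_pos (sub_pos.2 s1) (sub_pos.2 hA)]

lemma nxt_val_lt {n : ℕ} (i : ℕ) (h : i + 1 < n) :
    nxt (⟨i, by omega⟩ : Fin n) = ⟨i + 1, h⟩ := by
  simp only [nxt, Fin.mk.injEq]; exact Nat.mod_eq_of_lt h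

lemma nxt_val_last {n : ℕ} :
    nxt (⟨n, by omega⟩ : Fin (n + 1)) = ⟨0, by omega⟩ := by
  simp [nxt]

/-- The diagonal cutting off the last vertex is a supporting line of the others. -/
lemma diag {n : ℕ} (hn : 3 ≤ n) (V : Fin (n + 1) → ℝ × ℝ) (h : Good V) :
    ∃ f : Fnl, f (V ⟨0, by omega⟩) = f (V ⟨n - 1, by omega⟩) ∧
      ∀ k, (hk : k + 1 < n) → 0 < k → f (V ⟨k, by omega⟩) < f (V ⟨n - 1, by omega⟩) := by
  set A := V ⟨n - 1, by omega⟩ with hA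
  set B := V ⟨0, by omega⟩ with hB
  have hAB : A ≠ B := h.inj (by omega) (by simp; omega)
  set L := lineF A B with hL
  have L0 : L ≠ 0 := lineF_ne A B hAB
  have hLB : L B = L A := lineF_eq A B
  have hz : ∀ k, (hk : k + 1 < n) → 0 < k → L (V ⟨k, by omega⟩) ≠ L A := by
    intro k hk k0 he
    refine h.strict (by omega) ⟨n - 1, by omega⟩ ⟨0, by omega⟩ ⟨k, by omega⟩ ?_ ?_ ?_
      (collinear_of_fnl L L0 _ _ _ hLB he) <;> simp <;> omega
  -- the functionals
  obtain ⟨f, fe, hf⟩ := h ⟨n, by omega⟩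
  obtain ⟨g, ge, hg⟩ := h ⟨n - 1, by omega⟩
  rw [nxt_val_last] at fe hf
  rw [nxt_val_lt _ (by omega)] at ge hg
  have fB : ∀ k, (hk : k < n) → 0 < k → f (V ⟨k, by omega⟩) < f B := by
    intro k hk k0
    rw [hB, fe]
    apply hf <;> simp <;> omega
  have gA : ∀ k, (hk : k + 1 < n) → g (V ⟨k, by omega⟩) < g A := by
    intro k hk
    apply hg <;> simp <;> omega
  have step : ∀ k, (hk : k + 2 < n) → 0 < k →
      (L (V ⟨k, by omega⟩) < L A ↔ L (V ⟨k + 1, by omega⟩) < L A) := by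
    intro k hk k0
    obtain ⟨u, ue, hu⟩ := h ⟨k, by omega⟩
    rw [nxt_val_lt _ (by omega)] at ue hu
    have uA : u A < u (V ⟨k, by omega⟩) := by apply hu <;> simp <;> omega
    have uB : u B < u (V ⟨k, by omega⟩) := by apply hu <;> simp; omega
    have fA : f A < f B := fB (n - 1) (by omega) (by omega)
    have gB : g B < g A := gA 0 (by omega)
    have f1 := fB k (by omega) k0
    have f2 := fB (k+1) (by omega) (by omega)
    have g1 := gA k (by omega)
    have g2 := gA (k+1) (by omega)
    constructor
    · intro h1
      by_contra h2
      exact no_cross A B _ _ hAB f g u fA f1 f2 gB g1 g2 ue uA uB h1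
        (lt_of_le_of_ne (not_lt.1 h2) (hz (k+1) (by omega) (by omega)).symm)
    · intro h1
      by_contra h2
      exact no_cross A B _ _ hAB f g u fA f2 f1 gB g2 g1 ue.symm (by rw [ue]; exact uA)
        (by rw [ue]; exact uB) h1
        (lt_of_le_of_ne (not_lt.1 h2) (hz k (by omega) (by omega)).symm)
  have all : ∀ k, (hk : k + 2 < n) →
      (L (V ⟨1, by omega⟩) < L A ↔ L (V ⟨k + 1, by omega⟩) < L A) := by
    intro k
    induction k with
    | zero => intro _; rfl
    | succ k ih => intro hk; exact (ih (by omega)).trans (step (k+1) hk (by omega))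
  by_cases h1 : L (V ⟨1, by omega⟩) < L A
  · refine ⟨L, hLB, ?_⟩
    intro k hk k0
    obtain ⟨k, rfl⟩ : ∃ m, k = m + 1 := ⟨k - 1, by omega⟩
    exact (all k (by omega)).1 h1
  · refine ⟨-L, by simp [hLB], ?_⟩
    intro k hk k0
    have hne := hz k hk k0
    obtain ⟨k, rfl⟩ : ∃ m, k = m + 1 := ⟨k - 1, by omega⟩
    have h2 := mt (all k (by omega)).2 h1
    have h3 := lt_of_le_of_ne (not_lt.1 h2) hne.symm
    simpa using h3

lemma good_del {n : ℕ} (hn : 3 ≤ n) (V : Fin (n + 1) → ℝ × ℝ) (h : Good V) :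
    Good (V ∘ Fin.castSucc) := by
  rintro ⟨i, hi⟩
  rcases Nat.lt_or_ge (i + 1) n with h1 | h1
  · obtain ⟨f, fe, hf⟩ := h ⟨i, by omega⟩
    rw [nxt_val_lt _ (by omega)] at fe hf
    refine ⟨f, ?_, ?_⟩
    · rw [nxt_val_lt _ h1]; exact fe
    · rintro ⟨j, hj⟩ hji hjn
      rw [nxt_val_lt _ h1] at hjn
      apply hf
      · simpa using hji
      · simpa using hjn
  · obtain rfl : i = n - 1 := by omega
    have hnx : nxt (⟨n - 1, hi⟩ : Fin n) = ⟨0, by omega⟩ := by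
      simp only [nxt, Fin.mk.injEq]
      rw [Nat.sub_add_cancel (by omega)]; simp
    obtain ⟨f, fe, hf⟩ := diag hn V h
    refine ⟨f, ?_, ?_⟩
    · rw [hnx]; exact fe
    · rintro ⟨j, hj⟩ hji hjn
      rw [hnx] at hjn
      simp only [ne_eq, Fin.mk.injEq] at hji hjn
      exact hf j (by omega) (by omega)

lemma frontier_segment2 (p q : ℝ × ℝ) : frontier (segment ℝ p q) = segment ℝ p q := by
  have hfin : ({p, q} : Set (ℝ × ℝ)).Finite := by simp
  rw [← convexHull_pair]
  have hcl : IsClosed (convexHull ℝ ({p, q} : Set (ℝ × ℝ))) := hfin.isClosed_convexHull ℝ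
  rw [hcl.frontier_eq]
  have : interior (convexHull ℝ ({p, q} : Set (ℝ × ℝ))) = ∅ := by
    by_contra hne
    have h1 := interior_convexHull_nonempty_iff_affineSpan_eq_top.1
      (Set.nonempty_iff_ne_empty.2 hne)
    have h2 := collinear_iff_finrank_le_one.1 (collinear_pair ℝ p q)
    rw [← direction_affineSpan, h1, AffineSubspace.direction_top, finrank_top] at h2
    simp at h2
  rw [this, Set.sdiff_empty]

/-- Deleting the last vertex of a quasi-strictly convex polygon yields a
quasi-strictly convex polygon. -/
theorem stmt_10 (n : ℕ) (V : Fin (n + 1) → ℝ × ℝ)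
    (h : IsConvexPolygon V ∧ QuasiStrict V) :
    IsConvexPolygon (V ∘ Fin.castSucc) ∧ QuasiStrict (V ∘ Fin.castSucc) := by
  obtain ⟨hc, hq⟩ := h
  rcases Nat.lt_or_ge n 3 with hn | hn
  · refine ⟨?_, ?_⟩
    · unfold IsConvexPolygon
      interval_cases n
      · simp
      · have e : Set.range (V ∘ Fin.castSucc) = {V 0} := by
          rw [Set.range_unique]; rfl
        rw [e, ← Set.pair_eq_singleton, convexHull_pair, frontier_segment2]
        ext x
        simp [nxt]
      · have e : Set.range (V ∘ Fin.castSucc) = {V 0, V 1} := by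
          ext x; simp [Fin.exists_fin_two, eq_comm]
        rw [e, convexHull_pair, frontier_segment2]
        have e0 : nxt (0 : Fin 2) = 1 := rfl
        have e1 : nxt (1 : Fin 2) = 0 := rfl
        ext x
        simp only [Set.mem_iUnion, Fin.exists_fin_two, e0, e1]
        rw [segment_symm ℝ ((V ∘ Fin.castSucc) 1), or_self]
        rfl
    · intro i j h1 h2
      exfalso
      interval_cases n
      · exact i.elim0
      · exact h1 (Subsingleton.elim _ _)
      · revert i j; decide
  · have hg := good_del hn V (good_of_convex (by omega) V hc hq)
    exact ⟨hg.convex hn, hg.quasi hn⟩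
end

section
/- For n ≥ 4, none of the 3(n−3) conditions in the following test can be dropped: an n-gon is quasi-strictly convex if for all i ∈ {2,…,n−2}, (C1_i) V_{i+1},V_0 are strictly to one side of [V_{i−1},V_i], (C2_i) V_{i−1},V_0 are strictly to one side of [V_i,V_{i+1}], (C3_i) V_i,V_{i+1} are strictly to one side of [V_0,V_1]. That is, for each ω ∈ {1,2,3} and each i ∈ {2,…,n−2}, there exists a quasi-strict n-gon that satisfies all of the 3(n−3) conditions except (Cω_i), yet fails to be convex. -/
/-- Condition (Cω_i) of Lemma 4: ω = 1, 2, 3 give (C1_i), (C2_i), (C3_i). -/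
def cond3 {n : ℕ} (V : Fin n → ℝ × ℝ) (om : ℕ) (i : Fin n) : Prop :=
  let prev : Fin n := ⟨i.val - 1, lt_of_le_of_lt (Nat.sub_le _ _) i.isLt⟩
  let v0 : Fin n := ⟨0, Nat.zero_lt_of_lt i.isLt⟩
  let v1 : Fin n := ⟨1 % n, Nat.mod_lt _ (Nat.zero_lt_of_lt i.isLt)⟩
  if om = 1 then StrictSide (V prev) (V i) {V (nxt i), V v0}
  else if om = 2 then StrictSide (V i) (V (nxt i)) {V prev, V v0}
  else StrictSide (V v0) (V v1) {V i, V (nxt i)}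


/-- Twice the signed area. -/
def sArea (P Q R : ℝ × ℝ) : ℝ := (Q.1 - P.1) * (R.2 - P.2) - (Q.2 - P.2) * (R.1 - P.1)

lemma not_collinear_of_sArea {P Q R : ℝ × ℝ} (h : sArea P Q R ≠ 0) :
    ¬ Collinear ℝ ({P, Q, R} : Set (ℝ × ℝ)) := by
  intro hc
  rw [collinear_iff_of_mem (p₀ := P) (by simp)] at hc
  obtain ⟨v, hv⟩ := hc
  obtain ⟨r, hr⟩ := hv Q (by simp)
  obtain ⟨s, hs⟩ := hv R (by simp)
  apply h
  subst hr hs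
  simp [sArea]
  ring

lemma strictSide_of_sArea {P Q A B : ℝ × ℝ} (h : 0 < sArea P Q A * sArea P Q B) :
    StrictSide P Q {A, B} := by
  have key : ∀ s : ℝ, 0 < s * sArea P Q A → 0 < s * sArea P Q B → StrictSide P Q {A, B} := by
    intro s hA hB
    refine ⟨(-(s * (Q.2 - P.2)), s * (Q.1 - P.1)), ?_, ?_, ?_⟩
    · intro h0
      have h1 := congrArg Prod.fst h0
      have h2 := congrArg Prod.snd h0
      simp only [Prod.fst_zero, Prod.snd_zero] at h1 h2
      have : s * sArea P Q A = 0 := by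
        unfold sArea
        linear_combination (A.2 - P.2) * h2 + (A.1 - P.1) * h1
      linarith
    · simp [dot2]; ring
    · intro C hC
      have e : dot2 (-(s * (Q.2 - P.2)), s * (Q.1 - P.1)) (C - P) = s * sArea P Q C := by
        simp [dot2, sArea]; ring
      rw [e]
      rcases hC with rfl | rfl
      · exact hA
      · exact hB
  rcases pos_and_pos_or_neg_and_neg_of_mul_pos h with ⟨h1, h2⟩ | ⟨h1, h2⟩
  · exact key 1 (by linarith) (by linarith)
  · exact key (-1) (by linarith) (by linarith)

lemma not_strictSide_of_sArea {P Q A B : ℝ × ℝ} (h : sArea P Q A * sArea P Q B < 0) :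
    ¬ StrictSide P Q {A, B} := by
  rintro ⟨nv, -, h0, hS⟩
  have hA := hS A (by simp)
  have hB := hS B (by simp)
  set L := (Q.1 - P.1) ^ 2 + (Q.2 - P.2) ^ 2 with hL
  set m := nv.2 * (Q.1 - P.1) - nv.1 * (Q.2 - P.2) with hm
  simp only [dot2, Prod.fst_sub, Prod.snd_sub] at h0 hA hB
  have eA : (nv.1 * (A.1 - P.1) + nv.2 * (A.2 - P.2)) * L = m * sArea P Q A := by
    rw [hL, hm]; unfold sArea
    linear_combination ((A.1 - P.1) * (Q.1 - P.1) + (A.2 - P.2) * (Q.2 - P.2)) * h0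
  have eB : (nv.1 * (B.1 - P.1) + nv.2 * (B.2 - P.2)) * L = m * sArea P Q B := by
    rw [hL, hm]; unfold sArea
    linear_combination ((B.1 - P.1) * (Q.1 - P.1) + (B.2 - P.2) * (Q.2 - P.2)) * h0
  have hL0 : 0 < L := by
    rcases (by positivity : 0 ≤ L).lt_or_eq with h' | h'
    · exact h'
    · exfalso
      have h1 : Q.1 - P.1 = 0 := by nlinarith [sq_nonneg (Q.1 - P.1), sq_nonneg (Q.2 - P.2)]
      have h2 : Q.2 - P.2 = 0 := by nlinarith [sq_nonneg (Q.1 - P.1), sq_nonneg (Q.2 - P.2)]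
      simp [sArea, h1, h2] at h
  have p1 := mul_pos (mul_pos hA hL0) (mul_pos hB hL0)
  rw [eA, eB] at p1
  nlinarith [sq_nonneg m]

lemma mem_hull_of_sArea {P Q A X : ℝ × ℝ} {S : Set (ℝ × ℝ)} (hP : P ∈ S) (hQ : Q ∈ S) (hA : A ∈ S)
    (h : sArea P Q A ≠ 0) (h1 : 0 ≤ sArea X Q A / sArea P Q A)
    (h2 : 0 ≤ sArea P X A / sArea P Q A) (h3 : 0 ≤ sArea P Q X / sArea P Q A) :
    X ∈ convexHull ℝ S := by
  have hs : sArea X Q A / sArea P Q A + sArea P X A / sArea P Q A + sArea P Q X / sArea P Q A = 1 := by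
    field_simp
    unfold sArea; ring
  have hc := convex_convexHull ℝ S
  have hX : (sArea X Q A / sArea P Q A) • P + (sArea P X A / sArea P Q A) • Q +
      (sArea P Q X / sArea P Q A) • A = X := by
    ext
    · simp only [Prod.fst_add, Prod.smul_fst, smul_eq_mul]
      field_simp
      unfold sArea; ring
    · simp only [Prod.snd_add, Prod.smul_snd, smul_eq_mul]
      field_simp
      unfold sArea; ring
  have hm := hc.sum_mem (t := Finset.univ)
    (w := ![sArea X Q A / sArea P Q A, sArea P X A / sArea P Q A, sArea P Q X / sArea P Q A])
    (z := ![P, Q, A]) (by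
      intro i _; fin_cases i
      · exact h1
      · exact h2
      · exact h3)
    (by simpa [Fin.sum_univ_three] using hs)
    (by
      intro i _; fin_cases i
      · exact subset_convexHull ℝ S hP
      · exact subset_convexHull ℝ S hQ
      · exact subset_convexHull ℝ S hA)
  simpa [Fin.sum_univ_three, hX] using hm

lemma mid_interior {P Q A B : ℝ × ℝ} {S : Set (ℝ × ℝ)} (hP : P ∈ S) (hQ : Q ∈ S) (hA : A ∈ S)
    (hB : B ∈ S) (h1 : 0 < sArea P Q A) (h2 : sArea P Q B < 0) :
    midpoint ℝ P Q ∈ interior (convexHull ℝ S) := by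
  have hM1 : (midpoint ℝ P Q).1 = (P.1 + Q.1) / 2 := by
    simp [midpoint_eq_smul_add]; ring
  have hM2 : (midpoint ℝ P Q).2 = (P.2 + Q.2) / 2 := by
    simp [midpoint_eq_smul_add]; ring
  rw [mem_interior]
  refine ⟨{X | 0 < sArea X Q A} ∩ {X | 0 < sArea P X A} ∩ {X | sArea X Q B < 0} ∩
    {X | sArea P X B < 0}, ?_, ?_, ?_⟩
  · rintro X ⟨⟨⟨a, b⟩, c⟩, d⟩
    simp only [Set.mem_ofPred_eq] at a b c d
    rcases le_total 0 (sArea P Q X) with h | h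
    · exact mem_hull_of_sArea hP hQ hA h1.ne' (by positivity) (by positivity) (by positivity)
    · exact mem_hull_of_sArea hP hQ hB h2.ne (div_nonneg_of_nonpos c.le h2.le)
        (div_nonneg_of_nonpos d.le h2.le) (div_nonneg_of_nonpos h h2.le)
  · refine ((IsOpen.inter ?_ ?_).inter ?_).inter ?_
    · exact isOpen_lt (by fun_prop) (by unfold sArea; fun_prop)
    · exact isOpen_lt (by fun_prop) (by unfold sArea; fun_prop)
    · exact isOpen_lt (by unfold sArea; fun_prop) (by fun_prop)
    · exact isOpen_lt (by unfold sArea; fun_prop) (by fun_prop)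
  · unfold sArea at *
    simp only [Set.mem_inter_iff, Set.mem_ofPred_eq, hM1, hM2]
    refine ⟨⟨⟨?_, ?_⟩, ?_⟩, ?_⟩ <;> linarith

lemma not_convex_of_sArea {n : ℕ} (V : Fin n → ℝ × ℝ) (i a b : Fin n)
    (h : sArea (V i) (V (nxt i)) (V a) * sArea (V i) (V (nxt i)) (V b) < 0) :
    ¬ IsConvexPolygon V := by
  intro hc
  unfold IsConvexPolygon at hc
  have hmem : midpoint ℝ (V i) (V (nxt i)) ∈ frontier (convexHull ℝ (Set.range V)) := by
    rw [← hc]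
    exact Set.mem_iUnion.2 ⟨i, midpoint_mem_segment _ _⟩
  have hint : midpoint ℝ (V i) (V (nxt i)) ∈ interior (convexHull ℝ (Set.range V)) := by
    rcases mul_neg_iff.1 h with ⟨h1, h2⟩ | ⟨h1, h2⟩
    · exact mid_interior ⟨_, rfl⟩ ⟨_, rfl⟩ ⟨a, rfl⟩ ⟨b, rfl⟩ h1 h2
    · exact mid_interior ⟨_, rfl⟩ ⟨_, rfl⟩ ⟨b, rfl⟩ ⟨a, rfl⟩ h2 h1
  exact hmem.2 hint

/-- The product of signed areas deciding condition (Cω_j). -/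
def condVal (V : ℕ → ℝ × ℝ) (om j : ℕ) : ℝ :=
  if om = 1 then sArea (V (j - 1)) (V j) (V (j + 1)) * sArea (V (j - 1)) (V j) (V 0)
  else if om = 2 then sArea (V j) (V (j + 1)) (V (j - 1)) * sArea (V j) (V (j + 1)) (V 0)
  else sArea (V 0) (V 1) (V j) * sArea (V 0) (V 1) (V (j + 1))

lemma wrapper (n : ℕ) (hn : 4 ≤ n) (om : ℕ) (i : Fin n) (hi2 : 2 ≤ i.val) (hi : i.val ≤ n - 2)
    (V : ℕ → ℝ × ℝ)
    (hq : ∀ a j, a + 1 < n → j < n → j ≠ a → j ≠ a + 1 → sArea (V a) (V (a + 1)) (V j) ≠ 0)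
    (hl : ∀ j, 1 ≤ j → j < n - 1 → sArea (V (n - 1)) (V 0) (V j) ≠ 0)
    (hpos : ∀ om' ∈ ({1, 2, 3} : Set ℕ), ∀ j, 2 ≤ j → j + 2 ≤ n → (om' ≠ om ∨ j ≠ i.val) →
      0 < condVal V om' j)
    (hneg : condVal V om i.val < 0) :
    ∃ V : Fin n → ℝ × ℝ, QuasiStrict V ∧ ¬ IsConvexPolygon V ∧
      (∀ om' : ℕ, om' ∈ ({1, 2, 3} : Set ℕ) → ∀ j : Fin n, 2 ≤ j.val → j.val ≤ n - 2 →
        (om', j) ≠ (om, i) → cond3 V om' j) ∧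
      ¬ cond3 V om i := by
  have h1n : 1 % n = 1 := Nat.mod_eq_of_lt (by omega)
  have hnx : ∀ j : Fin n, j.val + 1 < n → (nxt j).val = j.val + 1 := by
    intro j hj
    simp [nxt, Nat.mod_eq_of_lt hj]
  refine ⟨fun j => V j.val, ?_, ?_, ?_, ?_⟩
  · intro a j ha hb
    apply not_collinear_of_sArea
    by_cases h : a.val + 1 < n
    · have := hnx a h
      simp only [this]
      refine hq a.val j.val h j.isLt (fun h => ha (Fin.ext h)) (fun h => hb (Fin.ext (by omega)))
    · have e : a.val = n - 1 := by have := a.isLt; omega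
      have e2 : (nxt a).val = 0 := by
        simp only [nxt, e]
        rw [Nat.sub_add_cancel (by omega), Nat.mod_self]
      simp only [e2, e]
      have j1 : j.val ≠ a.val := fun h => ha (Fin.ext h)
      have j2 : j.val ≠ (nxt a).val := fun h => hb (Fin.ext h)
      have := j.isLt
      exact hl j.val (by omega) (by omega)
  · unfold condVal at hneg
    split_ifs at hneg with c1 c2
    · refine not_convex_of_sArea _ ⟨i.val - 1, by omega⟩ ⟨i.val + 1, by omega⟩ ⟨0, by omega⟩ ?_
      have e := hnx ⟨i.val - 1, by omega⟩ (by simp only; omega)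
      simp only at e
      rw [Nat.sub_add_cancel (by omega)] at e
      simp only [e]
      exact hneg
    · refine not_convex_of_sArea _ i ⟨i.val - 1, by omega⟩ ⟨0, by omega⟩ ?_
      have e := hnx i (by omega)
      simp only [e]
      exact hneg
    · refine not_convex_of_sArea _ ⟨0, by omega⟩ i ⟨i.val + 1, by omega⟩ ?_
      have e := hnx ⟨0, by omega⟩ (by simp only; omega)
      simp only [zero_add] at e
      simp only [e]
      exact hneg
  · intro om' hom' j hj2 hj hne
    have hp := hpos om' hom' j.val hj2 (by omega) (by
      by_contra hcon
      push Not at hcon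
      exact hne (Prod.ext hcon.1 (Fin.ext hcon.2)))
    have e := hnx j (by omega)
    unfold condVal at hp
    simp only [cond3, e, h1n]
    split_ifs at hp ⊢ with c1 c2
    · exact strictSide_of_sArea hp
    · exact strictSide_of_sArea hp
    · exact strictSide_of_sArea hp
  · have e := hnx i (by omega)
    unfold condVal at hneg
    simp only [cond3, e, h1n]
    split_ifs at hneg ⊢ with c1 c2
    · exact not_strictSide_of_sArea hneg
    · exact not_strictSide_of_sArea hneg
    · exact not_strictSide_of_sArea hneg

/-- `V 0` on the vertical axis, all other vertices on the parabola. -/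
def parab (t : ℕ → ℝ) (q : ℝ) (i : ℕ) : ℝ × ℝ := if i = 0 then (0, q) else (t i, t i ^ 2)

lemma parab_zero (t : ℕ → ℝ) (q : ℝ) : parab t q 0 = (0, q) := by simp [parab]

lemma parab_pos (t : ℕ → ℝ) (q : ℝ) {i : ℕ} (h : 1 ≤ i) : parab t q i = (t i, t i ^ 2) := by
  have : i ≠ 0 := by omega
  simp [parab, this]

lemma sA_ppp (a b c : ℝ) : sArea (a, a ^ 2) (b, b ^ 2) (c, c ^ 2) = (b - a) * (c - a) * (c - b) := by
  simp [sArea]; ring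
lemma sA_pp0 (a b q : ℝ) : sArea (a, a ^ 2) (b, b ^ 2) (0, q) = (b - a) * (q + a * b) := by
  simp [sArea]; ring
lemma sA_0pp (a b q : ℝ) : sArea (0, q) (a, a ^ 2) (b, b ^ 2) = (b - a) * (q + a * b) := by
  simp [sArea]; ring
lemma sA_p0p (a b q : ℝ) : sArea (a, a ^ 2) (0, q) (b, b ^ 2) = (a - b) * (q + a * b) := by
  simp [sArea]; ring

lemma parab_wrapper (n : ℕ) (hn : 4 ≤ n) (om : ℕ) (i : Fin n) (hi2 : 2 ≤ i.val) (hi : i.val ≤ n - 2)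
    (t : ℕ → ℝ) (q : ℝ)
    (hinj : ∀ a b, 1 ≤ a → a < b → t a ≠ t b)
    (hq : ∀ a b, 1 ≤ a → a < b → q + t a * t b ≠ 0)
    (hpos : ∀ om' ∈ ({1, 2, 3} : Set ℕ), ∀ j, 2 ≤ j → j + 2 ≤ n → (om' ≠ om ∨ j ≠ i.val) →
      0 < condVal (parab t q) om' j)
    (hneg : condVal (parab t q) om i.val < 0) :
    ∃ V : Fin n → ℝ × ℝ, QuasiStrict V ∧ ¬ IsConvexPolygon V ∧
      (∀ om' : ℕ, om' ∈ ({1, 2, 3} : Set ℕ) → ∀ j : Fin n, 2 ≤ j.val → j.val ≤ n - 2 →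
        (om', j) ≠ (om, i) → cond3 V om' j) ∧
      ¬ cond3 V om i := by
  have hinj' : ∀ a b, 1 ≤ a → 1 ≤ b → a ≠ b → t a - t b ≠ 0 := by
    intro a b ha hb hab
    rcases lt_or_gt_of_ne hab with h | h
    · exact sub_ne_zero.2 (hinj a b ha h)
    · exact sub_ne_zero.2 (hinj b a hb h).symm
  have hq' : ∀ a b, 1 ≤ a → 1 ≤ b → a ≠ b → q + t a * t b ≠ 0 := by
    intro a b ha hb hab
    rcases lt_or_gt_of_ne hab with h | h
    · exact hq a b ha h
    · rw [mul_comm]; exact hq b a hb h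
  refine wrapper n hn om i hi2 hi (parab t q) ?_ ?_ hpos hneg
  · intro a j ha hj h1 h2
    rcases Nat.eq_zero_or_pos a with rfl | ha0
    · rw [parab_zero, parab_pos t q (by omega : 1 ≤ 0 + 1), parab_pos t q (by omega : 1 ≤ j), sA_0pp]
      exact mul_ne_zero (hinj' _ _ (by omega) (by omega) (by omega))
        (hq' _ _ (by omega) (by omega) (by omega))
    · rcases Nat.eq_zero_or_pos j with rfl | hj0
      · rw [parab_zero, parab_pos t q (by omega : 1 ≤ a), parab_pos t q (by omega : 1 ≤ a + 1), sA_pp0]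
        exact mul_ne_zero (hinj' _ _ (by omega) (by omega) (by omega))
          (hq' _ _ (by omega) (by omega) (by omega))
      · rw [parab_pos t q (by omega : 1 ≤ a), parab_pos t q (by omega : 1 ≤ a + 1),
          parab_pos t q (by omega : 1 ≤ j), sA_ppp]
        exact mul_ne_zero (mul_ne_zero (hinj' _ _ (by omega) (by omega) (by omega))
          (hinj' _ _ (by omega) (by omega) (by omega))) (hinj' _ _ (by omega) (by omega) (by omega))
  · intro j h1 h2
    rw [parab_zero, parab_pos t q (by omega : 1 ≤ n - 1), parab_pos t q (by omega : 1 ≤ j), sA_p0p]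
    exact mul_ne_zero (hinj' _ _ (by omega) (by omega) (by omega))
      (hq' _ _ (by omega) (by omega) (by omega))

lemma parab_val1 (t : ℕ → ℝ) (q : ℝ) {j : ℕ} (hj : 2 ≤ j) : condVal (parab t q) 1 j =
    (t j - t (j - 1)) ^ 2 * (((t (j + 1) - t j) * (t (j + 1) - t (j - 1))) *
      (q + t (j - 1) * t j)) := by
  simp only [condVal, if_true]
  rw [parab_zero, parab_pos t q (by omega : 1 ≤ j - 1), parab_pos t q (by omega : 1 ≤ j),
    parab_pos t q (by omega : 1 ≤ j + 1), sA_ppp, sA_pp0]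
  ring

lemma parab_val2 (t : ℕ → ℝ) (q : ℝ) {j : ℕ} (hj : 2 ≤ j) : condVal (parab t q) 2 j =
    (t (j + 1) - t j) ^ 2 * (((t j - t (j - 1)) * (t (j + 1) - t (j - 1))) *
      (q + t j * t (j + 1))) := by
  simp only [condVal]
  norm_num
  rw [parab_zero, parab_pos t q (by omega : 1 ≤ j - 1), parab_pos t q (by omega : 1 ≤ j),
    parab_pos t q (by omega : 1 ≤ j + 1), sA_ppp, sA_pp0]
  ring

lemma parab_val3 (t : ℕ → ℝ) (q : ℝ) {j : ℕ} (hj : 2 ≤ j) : condVal (parab t q) 3 j =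
    ((t j - t 1) * (t (j + 1) - t 1)) * ((q + t 1 * t j) * (q + t 1 * t (j + 1))) := by
  simp only [condVal]
  norm_num
  rw [parab_zero, parab_pos t q (by omega : 1 ≤ 1), parab_pos t q (by omega : 1 ≤ j),
    parab_pos t q (by omega : 1 ≤ j + 1), sA_0pp, sA_0pp]
  ring

/-- Cases ω = 1, and ω = 2 with k ≥ 3. -/
lemma case12 (n : ℕ) (hn : 4 ≤ n) (om : ℕ) (i : Fin n) (hi2 : 2 ≤ i.val) (hi : i.val ≤ n - 2)
    (m : ℕ) (hm1 : 1 ≤ m)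
    (hm : (om = 1 ∧ m + 1 = i.val) ∨ (om = 2 ∧ m + 1 < i.val)) :
    ∃ V : Fin n → ℝ × ℝ, QuasiStrict V ∧ ¬ IsConvexPolygon V ∧
      (∀ om' : ℕ, om' ∈ ({1, 2, 3} : Set ℕ) → ∀ j : Fin n, 2 ≤ j.val → j.val ≤ n - 2 →
        (om', j) ≠ (om, i) → cond3 V om' j) ∧
      ¬ cond3 V om i := by
  obtain ⟨k, hk⟩ : ∃ k, k = i.val := ⟨_, rfl⟩
  obtain ⟨t, ht⟩ : ∃ t : ℕ → ℝ, t = fun b => if b ≤ k then (b : ℝ) else m + 1 / ((b - k : ℕ) + 1 : ℝ) :=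
    ⟨_, rfl⟩
  have hmk : m + 1 ≤ k := by omega
  have hmkR : (m : ℝ) + 1 ≤ k := by exact_mod_cast hmk
  have hm1R : (1 : ℝ) ≤ m := by exact_mod_cast hm1
  have tlo : ∀ b, b ≤ k → t b = b := by intro b hb; simp [ht, hb]
  have thi : ∀ b, k < b → t b = m + 1 / ((b - k : ℕ) + 1 : ℝ) := by
    intro b hb; simp [ht, not_le.2 hb]
  have thi1 : ∀ b, k < b → (m : ℝ) < t b := by
    intro b hb
    rw [thi b hb]
    have : (0 : ℝ) < 1 / ((b - k : ℕ) + 1 : ℝ) := by positivity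
    linarith
  have thi2 : ∀ b, k < b → t b < m + 1 := by
    intro b hb
    rw [thi b hb]
    have h1 : (1 : ℝ) ≤ ((b - k : ℕ) : ℝ) := by exact_mod_cast (by omega : 1 ≤ b - k)
    have : 1 / ((b - k : ℕ) + 1 : ℝ) < 1 := by
      rw [div_lt_one (by positivity)]; linarith
    linarith
  have hinc : ∀ a b, a < b → b ≤ k → t a < t b := by
    intro a b hab hb
    rw [tlo a (by omega), tlo b hb]; exact_mod_cast hab
  have hdec : ∀ a b, k ≤ a → a < b → t b < t a := by
    intro a b ha hab
    rcases Nat.eq_or_lt_of_le ha with h | h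
    · rw [← h, tlo k le_rfl]
      have := thi2 b (by omega)
      linarith
    · rw [thi a h, thi b (by omega)]
      have h1 : ((a - k : ℕ) : ℝ) < ((b - k : ℕ) : ℝ) := by exact_mod_cast (by omega : a - k < b - k)
      have : 1 / ((b - k : ℕ) + 1 : ℝ) < 1 / ((a - k : ℕ) + 1 : ℝ) :=
        one_div_lt_one_div_of_lt (by positivity) (by linarith)
      linarith
  have t1 : t 1 = 1 := by rw [tlo 1 (by omega)]; simp
  have hgt : ∀ b, 2 ≤ b → t 1 < t b := by
    intro b hb
    by_cases h : b ≤ k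
    · exact hinc 1 b (by omega) h
    · have := thi1 b (by omega)
      rw [t1]; linarith
  have hge : ∀ b, 1 ≤ b → 0 < t b := by
    intro b hb
    rcases Nat.eq_or_lt_of_le hb with h | h
    · rw [← h, t1]; norm_num
    · have := hgt b h
      linarith
  have hqp : ∀ a b, 1 ≤ a → 1 ≤ b → 0 < 1 + t a * t b := by
    intro a b ha hb
    have := mul_pos (hge a ha) (hge b hb)
    linarith
  refine parab_wrapper n hn om i hi2 hi t 1 ?_ ?_ ?_ ?_
  · intro a b ha hab
    by_cases hb : b ≤ k
    · exact (hinc a b hab hb).ne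
    · by_cases hak : k ≤ a
      · exact (hdec a b hak hab).ne'
      · intro he
        have h1 := thi1 b (by omega)
        have h2 := thi2 b (by omega)
        rw [← he, tlo a (by omega)] at h1 h2
        have h1' : m < a := by exact_mod_cast h1
        have h2' : a < m + 1 := by exact_mod_cast h2
        omega
  · intro a b ha hab
    exact (hqp a b ha (by omega)).ne'
  · intro om' hom' j hj2 hj hne
    rw [← hk] at hne
    rcases hom' with rfl | rfl | rfl
    · rw [parab_val1 t 1 hj2]
      have hQ := hqp (j - 1) j (by omega) (by omega)
      rcases lt_trichotomy j k with h | h | h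
      · have e1 := hinc (j - 1) j (by omega) (by omega)
        have e2 := hinc j (j + 1) (by omega) (by omega)
        exact mul_pos (pow_pos (by linarith) 2) (mul_pos (mul_pos (by linarith) (by linarith)) hQ)
      · have e1 := hinc (j - 1) j (by omega) (by omega)
        have e2 := hdec j (j + 1) (by omega) (by omega)
        have e3 : t (j + 1) < t (j - 1) := by
          have a1 := thi2 (j + 1) (by omega)
          rw [tlo (j - 1) (by omega)]
          have : ((m + 1 : ℕ) : ℝ) ≤ ((j - 1 : ℕ) : ℝ) := by
            exact_mod_cast (by omega : m + 1 ≤ j - 1)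
          push_cast at this
          linarith
        exact mul_pos (pow_pos (by linarith) 2)
          (mul_pos (mul_pos_of_neg_of_neg (by linarith) (by linarith)) hQ)
      · have e1 := hdec (j - 1) j (by omega) (by omega)
        have e2 := hdec j (j + 1) (by omega) (by omega)
        exact mul_pos (sq_pos_of_neg (by linarith))
          (mul_pos (mul_pos_of_neg_of_neg (by linarith) (by linarith)) hQ)
    · rw [parab_val2 t 1 hj2]
      have hQ := hqp j (j + 1) (by omega) (by omega)
      rcases lt_trichotomy j k with h | h | h
      · have e1 := hinc (j - 1) j (by omega) (by omega)
        have e2 := hinc j (j + 1) (by omega) (by omega)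
        exact mul_pos (pow_pos (by linarith) 2) (mul_pos (mul_pos (by linarith) (by linarith)) hQ)
      · have e1 := hinc (j - 1) j (by omega) (by omega)
        have e2 := hdec j (j + 1) (by omega) (by omega)
        have e3 : t (j - 1) < t (j + 1) := by
          have a1 := thi1 (j + 1) (by omega)
          have : m = j - 1 := by omega
          rw [tlo (j - 1) (by omega), ← this]
          exact a1
        exact mul_pos (sq_pos_of_neg (by linarith))
          (mul_pos (mul_pos (by linarith) (by linarith)) hQ)
      · have e1 := hdec (j - 1) j (by omega) (by omega)
        have e2 := hdec j (j + 1) (by omega) (by omega)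
        exact mul_pos (sq_pos_of_neg (by linarith))
          (mul_pos (mul_pos_of_neg_of_neg (by linarith) (by linarith)) hQ)
    · rw [parab_val3 t 1 hj2]
      have e1 := hgt j hj2
      have e2 := hgt (j + 1) (by omega)
      exact mul_pos (mul_pos (by linarith) (by linarith))
        (mul_pos (hqp 1 j (by omega) (by omega)) (hqp 1 (j + 1) (by omega) (by omega)))
  · rw [← hk]
    have e1 := hinc (k - 1) k (by omega) (by omega)
    have e2 := hdec k (k + 1) (by omega) (by omega)
    rcases hm with ⟨rfl, h⟩ | ⟨rfl, h⟩
    · rw [parab_val1 t 1 (by omega)]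
      have hQ := hqp (k - 1) k (by omega) (by omega)
      have e3 : t (k - 1) < t (k + 1) := by
        have a1 := thi1 (k + 1) (by omega)
        have : m = k - 1 := by omega
        rw [tlo (k - 1) (by omega), ← this]
        exact a1
      exact mul_neg_of_pos_of_neg (pow_pos (by linarith) 2)
        (mul_neg_of_neg_of_pos (mul_neg_of_neg_of_pos (by linarith) (by linarith)) hQ)
    · rw [parab_val2 t 1 (by omega)]
      have hQ := hqp k (k + 1) (by omega) (by omega)
      have e3 : t (k + 1) < t (k - 1) := by
        have a1 := thi2 (k + 1) (by omega)
        rw [tlo (k - 1) (by omega)]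
        have : ((m + 1 : ℕ) : ℝ) ≤ ((k - 1 : ℕ) : ℝ) := by
          exact_mod_cast (by omega : m + 1 ≤ k - 1)
        push_cast at this
        linarith
      exact mul_neg_of_pos_of_neg (sq_pos_of_neg (by linarith))
        (mul_neg_of_neg_of_pos (mul_neg_of_pos_of_neg (by linarith) (by linarith)) hQ)

/-- Case ω = 3. -/
lemma case3 (n : ℕ) (hn : 4 ≤ n) (i : Fin n) (hi2 : 2 ≤ i.val) (hi : i.val ≤ n - 2) :
    ∃ V : Fin n → ℝ × ℝ, QuasiStrict V ∧ ¬ IsConvexPolygon V ∧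
      (∀ om' : ℕ, om' ∈ ({1, 2, 3} : Set ℕ) → ∀ j : Fin n, 2 ≤ j.val → j.val ≤ n - 2 →
        (om', j) ≠ (3, i) → cond3 V om' j) ∧
      ¬ cond3 V 3 i := by
  obtain ⟨k, hk⟩ : ∃ k, k = i.val := ⟨_, rfl⟩
  obtain ⟨t, ht⟩ : ∃ t : ℕ → ℝ, t = fun b : ℕ => if b ≤ 1 then (-1 : ℝ) else b := ⟨_, rfl⟩
  have t1 : t 1 = -1 := by simp [ht]
  have t2 : ∀ b, 2 ≤ b → t b = b := by
    intro b hb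
    have : ¬ b ≤ 1 := by omega
    simp [ht, this]
  have hinc : ∀ a b, 1 ≤ a → a < b → t a < t b := by
    intro a b ha hab
    rw [t2 b (by omega)]
    rcases Nat.eq_or_lt_of_le ha with h | h
    · rw [← h, t1]
      have : (0 : ℝ) ≤ b := by positivity
      linarith
    · rw [t2 a h]; exact_mod_cast hab
  have hlo : ∀ b, 2 ≤ b → b ≤ k → 0 < (k + 1 / 2 : ℝ) + t 1 * t b := by
    intro b h2 hb
    rw [t1, t2 b h2]
    have : (b : ℝ) ≤ k := by exact_mod_cast hb
    linarith
  have hhi : ∀ b, 2 ≤ b → k < b → (k + 1 / 2 : ℝ) + t 1 * t b < 0 := by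
    intro b h2 hb
    rw [t1, t2 b h2]
    have : (k : ℝ) + 1 ≤ b := by exact_mod_cast hb
    linarith
  have hpp : ∀ a b, 2 ≤ a → 2 ≤ b → 0 < (k + 1 / 2 : ℝ) + t a * t b := by
    intro a b ha hb
    rw [t2 a ha, t2 b hb]
    positivity
  have hnn : ∀ a, 1 ≤ a → a ≤ n → 0 < (k + 1 / 2 : ℝ) + t a * t (a + 1) := by
    intro a ha _
    rcases Nat.eq_or_lt_of_le ha with h | h
    · rw [← h]; exact hlo _ (by omega) (by omega)
    · exact hpp _ _ h (by omega)
  refine parab_wrapper n hn 3 i hi2 hi t (k + 1 / 2) ?_ ?_ ?_ ?_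
  · intro a b ha hab
    exact (hinc a b ha hab).ne
  · intro a b ha hab
    rcases Nat.eq_or_lt_of_le ha with h | h
    · rw [← h]
      by_cases hb : b ≤ k
      · exact (hlo b (by omega) hb).ne'
      · exact (hhi b (by omega) (by omega)).ne
    · exact (hpp a b h (by omega)).ne'
  · intro om' hom' j hj2 hj hne
    rw [← hk] at hne
    have e1 := hinc (j - 1) j (by omega) (by omega)
    have e2 := hinc j (j + 1) (by omega) (by omega)
    have e3 := hinc 1 j (by omega) (by omega)
    have hQ := hnn (j - 1) (by omega) (by omega)
    rw [Nat.sub_add_cancel (by omega)] at hQ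
    have hQ' := hnn j (by omega) (by omega)
    rcases hom' with rfl | rfl | rfl
    · rw [parab_val1 t _ hj2]
      exact mul_pos (pow_pos (by linarith) 2) (mul_pos (mul_pos (by linarith) (by linarith)) hQ)
    · rw [parab_val2 t _ hj2]
      exact mul_pos (pow_pos (by linarith) 2) (mul_pos (mul_pos (by linarith) (by linarith)) hQ')
    · rw [parab_val3 t _ hj2]
      refine mul_pos (mul_pos (by linarith) (by linarith)) ?_
      rcases lt_or_ge j k with h | h
      · exact mul_pos (hlo j hj2 (by omega)) (hlo _ (by omega) (by omega))
      · exact mul_pos_of_neg_of_neg (hhi j hj2 (by omega)) (hhi _ (by omega) (by omega))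
  · rw [← hk, parab_val3 t _ (by omega)]
    have e2 := hinc 1 k (by omega) (by omega)
    have e3 := hinc k (k + 1) (by omega) (by omega)
    exact mul_neg_of_pos_of_neg (mul_pos (by linarith) (by linarith))
      (mul_neg_of_pos_of_neg (hlo k (by omega) (by omega)) (hhi _ (by omega) (by omega)))

/-- Vertices for ω = 2, k = 2. -/
noncomputable def spec (i : ℕ) : ℝ × ℝ :=
  if i = 0 then (0, 1) else if i = 1 then (0, -1) else (1 / (i : ℝ), (1 / (i : ℝ)) ^ 2)

lemma sA_00p (a p q : ℝ) : sArea (0, q) (0, p) (a, a ^ 2) = (q - p) * a := by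
  simp [sArea]; ring
lemma sA_p00 (a p q : ℝ) : sArea (a, a ^ 2) (0, q) (0, p) = (q - p) * a := by
  simp [sArea]; ring
lemma sA_0p0 (a p q : ℝ) : sArea (0, q) (a, a ^ 2) (0, p) = (p - q) * a := by
  simp [sArea]; ring

/-- Case ω = 2, k = 2. -/
lemma case22 (n : ℕ) (hn : 4 ≤ n) (i : Fin n) (hi2 : i.val = 2) :
    ∃ V : Fin n → ℝ × ℝ, QuasiStrict V ∧ ¬ IsConvexPolygon V ∧
      (∀ om' : ℕ, om' ∈ ({1, 2, 3} : Set ℕ) → ∀ j : Fin n, 2 ≤ j.val → j.val ≤ n - 2 →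
        (om', j) ≠ (2, i) → cond3 V om' j) ∧
      ¬ cond3 V 2 i := by
  obtain ⟨t, ht⟩ : ∃ t : ℕ → ℝ, t = fun b : ℕ => 1 / (b : ℝ) := ⟨_, rfl⟩
  have s0 : spec 0 = (0, 1) := by simp [spec]
  have s1 : spec 1 = (0, -1) := by simp [spec]
  have s2 : ∀ j, 2 ≤ j → spec j = (t j, t j ^ 2) := by
    intro j hj
    have h1 : j ≠ 0 := by omega
    have h2 : j ≠ 1 := by omega
    simp [spec, h1, h2, ht]
  have tp : ∀ j, 2 ≤ j → 0 < t j := by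
    intro j hj
    have : (0 : ℝ) < j := by exact_mod_cast (by omega : 0 < j)
    rw [ht]; positivity
  have hdec : ∀ a b, 1 ≤ a → a < b → t b < t a := by
    intro a b ha hab
    rw [ht]
    exact one_div_lt_one_div_of_lt (by exact_mod_cast ha) (by exact_mod_cast hab)
  have t1 : ∀ j, 2 ≤ j → t j < 1 := by
    intro j hj
    have := hdec 1 j le_rfl (by omega)
    have e : t 1 = 1 := by simp [ht]
    linarith
  have hqp : ∀ a b, 2 ≤ a → 2 ≤ b → 0 < 1 + t a * t b := by
    intro a b ha hb
    have := mul_pos (tp a ha) (tp b hb)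
    linarith
  have hqm : ∀ a b, 2 ≤ a → 2 ≤ b → -1 + t a * t b < 0 := by
    intro a b ha hb
    have := mul_lt_one_of_nonneg_of_lt_one_left (tp a ha).le (t1 a ha) (t1 b hb).le
    linarith
  have hne : ∀ a b, 2 ≤ a → 2 ≤ b → a ≠ b → t a - t b ≠ 0 := by
    intro a b ha hb hab
    rcases lt_or_gt_of_ne hab with h | h
    · have := hdec a b (by omega) h
      exact (by linarith : 0 < t a - t b).ne'
    · have := hdec b a (by omega) h
      exact (by linarith : t a - t b < 0).ne
  refine wrapper n hn 2 i (by omega) (by omega) spec ?_ ?_ ?_ ?_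
  · intro a j ha hj h1 h2
    rcases (by omega : a = 0 ∨ a = 1 ∨ 2 ≤ a) with rfl | rfl | ha2
    · rw [s0, zero_add, s1, s2 j (by omega), sA_00p]
      have := tp j (by omega)
      exact mul_ne_zero (by norm_num) this.ne'
    · rw [s1, s2 (1 + 1) (by omega)]
      rcases Nat.eq_zero_or_pos j with rfl | hj0
      · rw [s0, sA_0p0]
        exact mul_ne_zero (by norm_num) (tp _ (by omega)).ne'
      · rw [s2 j (by omega), sA_0pp]
        exact mul_ne_zero (hne _ _ (by omega) (by omega) (by omega)) (hqm _ _ (by omega) (by omega)).ne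
    · rw [s2 a ha2, s2 (a + 1) (by omega)]
      rcases (by omega : j = 0 ∨ j = 1 ∨ 2 ≤ j) with rfl | rfl | hj2
      · rw [s0, sA_pp0]
        exact mul_ne_zero (hne _ _ (by omega) (by omega) (by omega)) (hqp _ _ (by omega) (by omega)).ne'
      · rw [s1, sA_pp0]
        exact mul_ne_zero (hne _ _ (by omega) (by omega) (by omega)) (hqm _ _ (by omega) (by omega)).ne
      · rw [s2 j hj2, sA_ppp]
        exact mul_ne_zero (mul_ne_zero (hne _ _ (by omega) (by omega) (by omega))
          (hne _ _ (by omega) (by omega) (by omega))) (hne _ _ (by omega) (by omega) (by omega))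
  · intro j h1 h2
    rw [s2 (n - 1) (by omega), s0]
    rcases Nat.eq_or_lt_of_le h1 with h | h
    · rw [← h, s1, sA_p00]
      exact mul_ne_zero (by norm_num) (tp _ (by omega)).ne'
    · rw [s2 j h, sA_p0p]
      exact mul_ne_zero (hne _ _ (by omega) (by omega) (by omega)) (hqp _ _ (by omega) (by omega)).ne'
  · intro om' hom' j hj2 hj hcase
    rw [hi2] at hcase
    have e2 := hdec j (j + 1) (by omega) (by omega)
    rcases hom' with rfl | rfl | rfl
    · simp only [condVal, if_true]
      rw [s0, s2 j hj2, s2 (j + 1) (by omega)]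
      rcases Nat.eq_or_lt_of_le hj2 with h | h
      · subst h
        rw [show 2 - 1 = 1 from rfl, s1, sA_0pp, sA_0p0]
        exact mul_pos (mul_pos_of_neg_of_neg (by linarith) (hqm _ _ (by omega) (by omega)))
          (mul_pos (by norm_num) (tp 2 le_rfl))
      · have e1 := hdec (j - 1) j (by omega) (by omega)
        rw [s2 (j - 1) (by omega), sA_ppp, sA_pp0]
        exact mul_pos_of_neg_of_neg
          (mul_neg_of_pos_of_neg (mul_pos_of_neg_of_neg (by linarith) (by linarith)) (by linarith))
          (mul_neg_of_neg_of_pos (by linarith) (hqp _ _ (by omega) (by omega)))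
    · have h : 2 < j := by omega
      have e1 := hdec (j - 1) j (by omega) (by omega)
      have e : condVal spec 2 j = sArea (spec j) (spec (j + 1)) (spec (j - 1)) *
        sArea (spec j) (spec (j + 1)) (spec 0) := by simp [condVal]
      rw [e, s0, s2 j hj2, s2 (j + 1) (by omega), s2 (j - 1) (by omega), sA_ppp, sA_pp0]
      exact mul_pos_of_neg_of_neg
          (mul_neg_of_neg_of_pos (mul_neg_of_neg_of_pos (by linarith) (by linarith)) (by linarith))
          (mul_neg_of_neg_of_pos (by linarith) (hqp _ _ (by omega) (by omega)))
    · have e : condVal spec 3 j = sArea (spec 0) (spec 1) (spec j) *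
        sArea (spec 0) (spec 1) (spec (j + 1)) := by simp [condVal]
      rw [e, s0, s1, s2 j hj2, s2 (j + 1) (by omega), sA_00p, sA_00p]
      exact mul_pos (mul_pos (by norm_num) (tp _ (by omega))) (mul_pos (by norm_num) (tp _ (by omega)))
  · have e : condVal spec 2 i.val = sArea (spec 2) (spec 3) (spec 1) *
        sArea (spec 2) (spec 3) (spec 0) := by simp [condVal, hi2]
    have e2 := hdec 2 3 (by omega) (by omega)
    rw [e, s0, s1, s2 2 le_rfl, s2 3 (by omega), sA_pp0, sA_pp0]
    exact mul_neg_of_pos_of_neg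
      (mul_pos_of_neg_of_neg (by linarith) (hqm _ _ (by omega) (by omega)))
      (mul_neg_of_neg_of_pos (by linarith) (hqp _ _ (by omega) (by omega)))

/-- Pinelis, Lemma 5 (minimality): for every ω ∈ {1,2,3} and i ∈ {2,…,n−2}
there is a quasi-strict, non-convex n-gon satisfying all conditions of the
test except (Cω_i). -/
theorem stmt_18 (n : ℕ) (hn : 4 ≤ n) (om : ℕ) (hom : om ∈ ({1, 2, 3} : Set ℕ))
    (i : Fin n) (hi2 : 2 ≤ i.val) (hi : i.val ≤ n - 2) :
    ∃ V : Fin n → ℝ × ℝ, QuasiStrict V ∧ ¬ IsConvexPolygon V ∧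
      (∀ om' : ℕ, om' ∈ ({1, 2, 3} : Set ℕ) → ∀ j : Fin n, 2 ≤ j.val → j.val ≤ n - 2 →
        (om', j) ≠ (om, i) → cond3 V om' j) ∧
      ¬ cond3 V om i := by
  rcases hom with rfl | rfl | rfl
  · exact case12 n hn 1 i hi2 hi (i.val - 1) (by omega) (Or.inl ⟨rfl, by omega⟩)
  · rcases Nat.eq_or_lt_of_le hi2 with h | h
    · exact case22 n hn i h.symm
    · exact case12 n hn 2 i hi2 hi 1 le_rfl (Or.inr ⟨rfl, by omega⟩)
  · exact case3 n hn i hi2 hi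
end
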